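/- arXiv:1512.06621 — 3 statements merged into one kernel-verified Lean document; each statement's English description precedes it below -/
import Mathlib

section
/- Every densely defined positive (self-adjoint, with ⟨x|Tx⟩ ≥ 0) right linear operator T in a quaternionic Hilbert space has a unique positive square root: there exists a unique positive operator C with D(C²) = D(T) and C² = T. Moreover C commutes with every bounded operator that commutes with T. -/
noncomputable section

open MulOpposite

local notation "ℍ" => Quaternion ℝ

variable {H : Type*} [NormedAddCommGroup H] [Module ℍᵐᵒᵖ H]

/-- The axioms of a quaternion-valued inner product compatible with the norm on a
right quaternionic module `H` (scalars act on the right via `ℍᵐᵒᵖ`). -/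
structure QInner (inn : H → H → ℍ) : Prop where
  add_right : ∀ u v w : H, inn u (v + w) = inn u v + inn u w
  smul_right : ∀ (u v : H) (q : ℍ), inn u (op q • v) = inn u v * q
  conj_symm : ∀ u v : H, inn u v = star (inn v u)
  norm_sq : ∀ u : H, inn u u = ((‖u‖ ^ 2 : ℝ) : ℍ)

/-- `B` is the adjoint of the bounded right linear operator `A`. -/
def IsAdjB (inn : H → H → ℍ) (A B : H →L[ℍᵐᵒᵖ] H) : Prop :=
  ∀ x y : H, inn (B x) y = inn x (A y)

/-- `A` is a positive bounded operator. -/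
def IsPosB (inn : H → H → ℍ) (A : H →L[ℍᵐᵒᵖ] H) : Prop :=
  IsAdjB inn A A ∧ ∀ x : H, ∃ r : ℝ, 0 ≤ r ∧ inn x (A x) = (r : ℍ)

/-- Orthogonal complement of a set. -/
def qOrth (inn : H → H → ℍ) (S : Set H) : Set H := {x | ∀ y ∈ S, inn y x = 0}

/-- Null space of a bounded operator. -/
def kerB (A : H →L[ℍᵐᵒᵖ] H) : Set H := {x | A x = 0}

/-- `U` is a partial isometry: it is isometric on `N(U)^⊥`. -/
def IsPartialIsomB (inn : H → H → ℍ) (U : H →L[ℍᵐᵒᵖ] H) : Prop :=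
  ∀ x ∈ qOrth inn (kerB U), ‖U x‖ = ‖x‖

/-- Null space of an unbounded operator. -/
def pKer (T : H →ₗ.[ℍᵐᵒᵖ] H) : Set H := {x | ∃ hx : x ∈ T.domain, T ⟨x, hx⟩ = 0}

/-- Range of an unbounded operator. -/
def pRan (T : H →ₗ.[ℍᵐᵒᵖ] H) : Set H := Set.range fun x : T.domain => T x

/-- `S` is the adjoint of the densely defined operator `T` : the formal adjoint
identity holds and the domain of `S` is maximal. -/
def IsAdjP (inn : H → H → ℍ) (T S : H →ₗ.[ℍᵐᵒᵖ] H) : Prop :=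
  (∀ (x : S.domain) (y : T.domain), inn (x : H) (T y) = inn (S x) (y : H)) ∧
  ∀ x z : H, (∀ y : T.domain, inn x (T y) = inn z (y : H)) → x ∈ S.domain

/-- `T` is a positive (self-adjoint) unbounded operator. -/
def IsPosP (inn : H → H → ℍ) (T : H →ₗ.[ℍᵐᵒᵖ] H) : Prop :=
  IsAdjP inn T T ∧ ∀ x : T.domain, ∃ r : ℝ, 0 ≤ r ∧ inn (x : H) (T x) = (r : ℍ)

/-- `C = S ∘ T` as unbounded operators, with the usual maximal domain. -/
def IsCompP (S T C : H →ₗ.[ℍᵐᵒᵖ] H) : Prop :=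
  (∀ x : H, x ∈ C.domain ↔ ∃ hx : x ∈ T.domain, T ⟨x, hx⟩ ∈ S.domain) ∧
  ∀ (x : C.domain) (hx : (x : H) ∈ T.domain) (h2 : T ⟨x, hx⟩ ∈ S.domain),
    C x = S ⟨T ⟨x, hx⟩, h2⟩

/-- `T = U ∘ P` where `U` is bounded and `T`, `P` are unbounded. -/
def EqCompB (T : H →ₗ.[ℍᵐᵒᵖ] H) (U : H →L[ℍᵐᵒᵖ] H) (P : H →ₗ.[ℍᵐᵒᵖ] H) : Prop :=
  T.domain = P.domain ∧
  ∀ (x : H) (hx : x ∈ T.domain) (hx' : x ∈ P.domain), T ⟨x, hx⟩ = U (P ⟨x, hx'⟩)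

/-- The bounded operator `B` commutes with the unbounded operator `T`, i.e. `TB ⊆ BT`. -/
def CommP (B : H →L[ℍᵐᵒᵖ] H) (T : H →ₗ.[ℍᵐᵒᵖ] H) : Prop :=
  ∀ x : T.domain, ∃ h : B (x : H) ∈ T.domain, T ⟨B (x : H), h⟩ = B (T x)


open scoped InnerProductSpace

section RealPart

variable {E : Type*} [NormedAddCommGroup E] [InnerProductSpace ℝ E]

/-- Positive bounded operators on a real inner product space. -/
def RPos (A : E →L[ℝ] E) : Prop :=
  (∀ x y, ⟪A x, y⟫_ℝ = ⟪x, A y⟫_ℝ) ∧ ∀ x, 0 ≤ ⟪A x, x⟫_ℝ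

/-- Coefficients of `1 - √(1 - t)`. -/
def sqc (n : ℕ) : ℝ := (catalan n : ℝ) / (2 * 4 ^ n)

lemma sqc_nonneg (n : ℕ) : 0 ≤ sqc n := by unfold sqc; positivity

lemma sqc_conv (n : ℕ) :
    ∑ p ∈ Finset.HasAntidiagonal.antidiagonal n, sqc p.1 * sqc p.2 = 2 * sqc (n + 1) := by
  have h : ∀ p ∈ Finset.HasAntidiagonal.antidiagonal n,
      sqc p.1 * sqc p.2 = (catalan p.1 * catalan p.2 : ℝ) / (4 * 4 ^ n) := by
    intro p hp
    rw [Finset.HasAntidiagonal.mem_antidiagonal] at hp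
    rw [← hp, pow_add]
    unfold sqc
    field_simp
    ring
  rw [Finset.sum_congr rfl h, ← Finset.sum_div]
  unfold sqc
  rw [catalan_succ']
  push_cast
  rw [pow_succ]
  field_simp

lemma sqc_sum_le (N : ℕ) : ∑ n ∈ Finset.range N, sqc n ≤ 1 := by
  induction N with
  | zero => simp
  | succ N ih =>
    rw [Finset.sum_range_succ']
    have h0 : sqc 0 = 1 / 2 := by simp [sqc]
    have h1 : ∑ n ∈ Finset.range N, 2 * sqc (n + 1) ≤ (∑ n ∈ Finset.range N, sqc n) ^ 2 := by
      simp_rw [← sqc_conv]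
      rw [sq, Finset.sum_mul_sum, ← Finset.sum_product', Finset.sum_sigma']
      rw [← Finset.sum_image (s := (Finset.range N).sigma fun n =>
        Finset.HasAntidiagonal.antidiagonal n) (g := fun x => x.2)
        (f := fun p : ℕ × ℕ => sqc p.1 * sqc p.2)]
      · refine Finset.sum_le_sum_of_subset_of_nonneg ?_ fun p _ _ =>
          mul_nonneg (sqc_nonneg _) (sqc_nonneg _)
        rintro ⟨a, b⟩ hp
        simp only [Finset.mem_image, Finset.mem_sigma, Finset.mem_range,
          Finset.HasAntidiagonal.mem_antidiagonal, Sigma.exists] at hp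
        obtain ⟨m, q, ⟨h1, h2⟩, rfl⟩ := hp
        simp only [Finset.mem_product, Finset.mem_range] at h2 ⊢
        omega
      · rintro ⟨m, q⟩ hm ⟨m', q'⟩ hm' hq
        simp only [Finset.coe_sigma, Set.mem_sigma_iff, Finset.mem_coe,
          Finset.HasAntidiagonal.mem_antidiagonal] at hm hm'
        dsimp only at hq
        subst hq
        obtain rfl : m = m' := hm.2.symm.trans hm'.2
        rfl
    rw [← Finset.mul_sum] at h1
    have h2 : 0 ≤ ∑ n ∈ Finset.range N, sqc n := Finset.sum_nonneg fun n _ => sqc_nonneg n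
    nlinarith

lemma sqc_summable : Summable sqc :=
  summable_of_sum_range_le sqc_nonneg sqc_sum_le

lemma sqc_tsum_le : ∑' n, sqc n ≤ 1 := Real.tsum_le_of_sum_range_le sqc_nonneg sqc_sum_le

lemma rpos_contract {X : E →L[ℝ] E} (h : RPos X) (h' : RPos (1 - X)) (x : E) : ‖X x‖ ≤ ‖x‖ := by
  have e1 := h'.2 (X x)
  have e2 := h.2 ((1 - X) x)
  have e3 := h'.2 x
  simp only [_root_.sub_apply, one_apply_eq_self, inner_sub_left,
    inner_sub_right, map_sub] at e1 e2 e3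
  have s1 : ⟪X (X x), x⟫_ℝ = ⟪X x, X x⟫_ℝ := h.1 _ _
  have n1 : ⟪X x, X x⟫_ℝ = ‖X x‖ ^ 2 := real_inner_self_eq_norm_sq _
  have n2 : ⟪x, x⟫_ℝ = ‖x‖ ^ 2 := real_inner_self_eq_norm_sq _
  have : ‖X x‖ ^ 2 ≤ ‖x‖ ^ 2 := by linarith
  exact le_of_sq_le_sq this (norm_nonneg _)

lemma rpos_one_sub_of_contract {X : E →L[ℝ] E} (h : ∀ x y, ⟪X x, y⟫_ℝ = ⟪x, X y⟫_ℝ)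
    (h' : ∀ x, ‖X x‖ ≤ ‖x‖) : RPos (1 - X) := by
  refine ⟨fun x y => ?_, fun x => ?_⟩
  · simp [inner_sub_left, inner_sub_right, h]
  · have := real_inner_le_norm (X x) x
    have n2 : ⟪x, x⟫_ℝ = ‖x‖ ^ 2 := real_inner_self_eq_norm_sq _
    simp only [_root_.sub_apply, one_apply_eq_self, inner_sub_left]
    nlinarith [h' x, norm_nonneg x]

lemma real_root [CompleteSpace E] {A : E →L[ℝ] E} (h : RPos A) (h' : RPos (1 - A)) :
    ∃ Q : E →L[ℝ] E, RPos Q ∧ Q * Q = A ∧ ∀ B : E →L[ℝ] E, Commute B A → Commute B Q := by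
  set X : E →L[ℝ] E := 1 - A with hX
  have hA : A = 1 - X := by simp [hX]
  have hXn : ‖X‖ ≤ 1 := by
    refine ContinuousLinearMap.opNorm_le_bound _ zero_le_one fun x => ?_
    rw [one_mul]
    exact rpos_contract h' (by rw [← hA]; exact h) x
  have hb : ∀ n, ‖sqc n • X ^ (n + 1)‖ ≤ sqc n := by
    intro n
    rw [norm_smul, Real.norm_of_nonneg (sqc_nonneg n)]
    have : ‖X ^ (n + 1)‖ ≤ 1 :=
      (norm_pow_le' X (Nat.succ_pos n)).trans (pow_le_one₀ (norm_nonneg _) hXn)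
    nlinarith [sqc_nonneg n]
  have hs : Summable fun n => ‖sqc n • X ^ (n + 1)‖ :=
    Summable.of_nonneg_of_le (fun _ => norm_nonneg _) hb sqc_summable
  set Y : E →L[ℝ] E := ∑' n, sqc n • X ^ (n + 1) with hY
  have hYs : HasSum (fun n => sqc n • X ^ (n + 1)) Y := hs.of_norm.hasSum
  have hYn : ‖Y‖ ≤ 1 :=
    (tsum_of_norm_bounded sqc_summable.hasSum hb).trans sqc_tsum_le
  have hYY : Y * Y = ∑' n, (2 * sqc (n + 1)) • X ^ (n + 2) := by
    rw [hY, tsum_mul_tsum_eq_tsum_sum_antidiagonal_of_summable_norm hs hs]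
    refine tsum_congr fun n => ?_
    rw [← sqc_conv, Finset.sum_smul]
    refine Finset.sum_congr rfl fun p hp => ?_
    rw [Finset.HasAntidiagonal.mem_antidiagonal] at hp
    rw [smul_mul_smul_comm, ← pow_add, ← hp]
    congr 2
    ring
  have h2Y : 2 • Y = X + Y * Y := by
    have e : Y = sqc 0 • X ^ (0 + 1) + ∑' n, sqc (n + 1) • X ^ (n + 1 + 1) :=
      hs.of_norm.tsum_eq_zero_add
    have e' : Y * Y = (2:ℝ) • ∑' n, sqc (n + 1) • X ^ (n + 1 + 1) := by
      rw [hYY, ← tsum_const_smul'']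
      simp only [smul_smul]
    rw [e']
    conv_lhs => rw [e]
    have h0 : sqc 0 = 1 / 2 := by simp [sqc]
    rw [h0, ← Nat.cast_smul_eq_nsmul ℝ, smul_add, smul_smul]
    norm_num
  have hXsym : ∀ n x y, ⟪(X ^ n) x, y⟫_ℝ = ⟪x, (X ^ n) y⟫_ℝ := by
    intro n
    induction n with
    | zero => simp
    | succ n ih =>
      intro x y
      rw [pow_succ, mul_apply_eq_comp, ih, h'.1, ← mul_apply_eq_comp,
        ← pow_succ', pow_succ]
  have hYsym : ∀ x y, ⟪Y x, y⟫_ℝ = ⟪x, Y y⟫_ℝ := by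
    intro x y
    have a1 : HasSum (fun n => ⟪(sqc n • X ^ (n + 1)) x, y⟫_ℝ) ⟪Y x, y⟫_ℝ := by
      have := (hYs.mapL (ContinuousLinearMap.apply ℝ E x)).mapL (innerSL ℝ y)
      simpa [real_inner_comm, inner_smul_left, inner_smul_right] using this
    have a2 : HasSum (fun n => ⟪x, (sqc n • X ^ (n + 1)) y⟫_ℝ) ⟪x, Y y⟫_ℝ := by
      have := (hYs.mapL (ContinuousLinearMap.apply ℝ E y)).mapL (innerSL ℝ x)
      simpa [inner_smul_right] using this
    refine a1.unique ?_
    convert a2 using 2 with n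
    change ⟪sqc n • (X ^ (n + 1)) x, y⟫_ℝ = ⟪x, sqc n • (X ^ (n + 1)) y⟫_ℝ
    rw [real_inner_smul_left, real_inner_smul_right, hXsym]
  refine ⟨1 - Y, rpos_one_sub_of_contract hYsym fun x => ?_, ?_, fun B hB => ?_⟩
  · simpa using Y.le_of_opNorm_le hYn x
  · rw [hA]
    have : (1 - Y) * (1 - Y) = 1 - 2 • Y + Y * Y := by noncomm_ring
    rw [this, h2Y]; abel
  · have hBX : Commute B X := (Commute.one_right B).sub_right hB
    refine (Commute.one_right B).sub_right ?_
    rw [hY]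
    refine Commute.tsum_right _ fun n => ?_
    exact (hBX.pow_right _).smul_right _

lemma rpos_mul [CompleteSpace E] {Q S : E →L[ℝ] E} (h : RPos Q) (h' : RPos (1 - Q))
    (hS : RPos S) (hc : Commute S Q) : RPos (Q * S) := by
  obtain ⟨P, hP, hPP, hPc⟩ := real_root h h'
  have hc' := hPc S hc
  have hc'' : ∀ x, S (P x) = P (S x) := fun x => DFunLike.congr_fun hc' x
  have hc3 : ∀ x, S (Q x) = Q (S x) := fun x => DFunLike.congr_fun hc x
  refine ⟨fun x y => ?_, fun x => ?_⟩
  · simp only [mul_apply_eq_comp]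
    rw [h.1, hS.1, hc3]
  · rw [← hPP]
    simp only [mul_apply_eq_comp]
    rw [hP.1, ← hc'']
    exact hS.2 _

lemma rpos_one_sub_root {Q R : E →L[ℝ] E} (h' : RPos (1 - R)) (hQ : RPos Q)
    (hQQ : Q * Q = R) : RPos (1 - Q) := by
  refine rpos_one_sub_of_contract hQ.1 fun x => ?_
  have := h'.2 x
  rw [← hQQ] at this
  simp only [_root_.sub_apply, one_apply_eq_self, inner_sub_left, mul_apply_eq_comp] at this
  rw [hQ.1, real_inner_self_eq_norm_sq, real_inner_self_eq_norm_sq] at this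
  exact le_of_sq_le_sq (by linarith) (norm_nonneg _)

lemma real_roots [CompleteSpace E] {R : E →L[ℝ] E} (h : RPos R) (h' : RPos (1 - R)) :
    ∃ Q S : E →L[ℝ] E, RPos Q ∧ RPos S ∧ RPos (1 - Q) ∧ RPos (1 - S) ∧
      Q * Q = R ∧ S * S = 1 - R ∧ Commute Q S ∧
      RPos (Q * S) ∧ ∀ B : E →L[ℝ] E, Commute B R → Commute B Q ∧ Commute B S := by
  have h'' : RPos (1 - (1 - R)) := by rwa [sub_sub_cancel]
  obtain ⟨Q, hQ, hQQ, hQc⟩ := real_root h h'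
  obtain ⟨S, hS, hSS, hSc⟩ := real_root h' h''
  have hc : ∀ B : E →L[ℝ] E, Commute B R → Commute B Q ∧ Commute B S := fun B hB =>
    ⟨hQc B hB, hSc B ((Commute.one_right B).sub_right hB)⟩
  have hQR : Commute Q R := by
    rw [← hQQ]; exact (Commute.refl Q).mul_right (Commute.refl Q)
  have hQS := (hc Q hQR).2
  have hQ1 := rpos_one_sub_root h' hQ hQQ
  exact ⟨Q, S, hQ, hS, hQ1, rpos_one_sub_root h'' hS hSS, hQQ, hSS, hQS,
    rpos_mul hQ hQ1 hS hQS.symm, hc⟩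

lemma rpos_unique {X Y : E →L[ℝ] E} (hX : RPos X) (hY : RPos Y) (hc : Commute X Y)
    (h : X * X = Y * Y) : X = Y := by
  have hc' : ∀ x, X (Y x) = Y (X x) := fun x => DFunLike.congr_fun hc x
  have h2 : ∀ x, X (X x) = Y (Y x) := fun x => DFunLike.congr_fun h x
  set D : E →L[ℝ] E := X - Y with hD
  have hDs : ∀ x y, ⟪D x, y⟫_ℝ = ⟪x, D y⟫_ℝ := by
    intro x y; simp [hD, inner_sub_left, inner_sub_right, hX.1, hY.1]
  have h3 : ∀ z, ⟪D (D z), D z⟫_ℝ = 0 := by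
    intro z
    have e : X (D z) + Y (D z) = 0 := by simp [hD, hc', h2]
    have e1 : ⟪X (D z), D z⟫_ℝ + ⟪Y (D z), D z⟫_ℝ = 0 := by
      rw [← inner_add_left, e, inner_zero_left]
    have p1 := hX.2 (D z)
    have p2 := hY.2 (D z)
    have : ⟪D (D z), D z⟫_ℝ = ⟪X (D z), D z⟫_ℝ - ⟪Y (D z), D z⟫_ℝ := by
      rw [← inner_sub_left]; rfl
    rw [this]; linarith
  have hsym : ((D * D * D : E →L[ℝ] E) : E →ₗ[ℝ] E).IsSymmetric := by
    intro x y
    simp [hDs]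
  have h4 : ((D * D * D : E →L[ℝ] E) : E →ₗ[ℝ] E) = 0 := by
    refine hsym.inner_map_self_eq_zero.mp fun x => ?_
    simpa [hDs] using h3 x
  have h5 : ∀ x, D (D (D x)) = 0 := fun x => DFunLike.congr_fun h4 x
  have kk : ∀ x, D (D x) = 0 → D x = 0 := by
    intro x hx
    rw [← inner_self_eq_zero (𝕜 := ℝ), hDs, hx, inner_zero_right]
  ext x
  have := kk _ (kk _ (h5 x))
  rwa [hD, _root_.sub_apply, sub_eq_zero] at this

/-- Resolvent of a positive self-adjoint relation. -/
lemma rel_resolvent [CompleteSpace E] (G : Submodule ℝ (E × E))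
    (hG : ∀ x y, (x, y) ∈ G ↔ ∀ u v, (u, v) ∈ G → ⟪x, v⟫_ℝ = ⟪y, u⟫_ℝ)
    (hp : ∀ x y, (x, y) ∈ G → 0 ≤ ⟪x, y⟫_ℝ) :
    ∃ A : E →L[ℝ] E, RPos A ∧ RPos (1 - A) ∧ ∀ x y, (x, y) ∈ G ↔ x = A (x + y) := by
  have hcl : IsClosed (G : Set (E × E)) := by
    have : (G : Set (E × E)) = ⋂ p : G, {q : E × E | ⟪q.1, p.1.2⟫_ℝ = ⟪q.2, p.1.1⟫_ℝ} := by
      ext ⟨x, y⟩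
      simp only [SetLike.mem_coe, hG x y, Set.mem_iInter, Set.mem_ofPred_eq, Subtype.forall,
        Prod.forall]
    rw [this]
    exact isClosed_iInter fun p => isClosed_eq (by fun_prop) (by fun_prop)
  have : CompleteSpace G := hcl.completeSpace_coe
  let f : G →L[ℝ] E := (ContinuousLinearMap.fst ℝ E E + ContinuousLinearMap.snd ℝ E E).comp G.subtypeL
  have hf : ∀ p : G, f p = p.1.1 + p.1.2 := fun p => rfl
  have hb : ∀ p : G, ‖p‖ ≤ ‖f p‖ := by
    rintro ⟨⟨x, y⟩, hxy⟩
    have h1 := hp x y hxy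
    have h2 := norm_add_sq_real x y
    rw [hf]
    show ‖(x, y)‖ ≤ ‖x + y‖
    rw [Prod.norm_def]
    refine max_le ?_ ?_
    · refine le_of_sq_le_sq ?_ (norm_nonneg _); nlinarith [norm_nonneg y]
    · refine le_of_sq_le_sq ?_ (norm_nonneg _); nlinarith [norm_nonneg x]
  have hanti : AntilipschitzWith 1 f :=
    ContinuousLinearMap.antilipschitz_of_bound f (by simpa using hb)
  have hrc : IsClosed (f.range : Set E) := by
    have := hanti.isClosed_range f.uniformContinuous
    convert this using 1
    ext z; simp
  have hrt : f.range = ⊤ := by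
    have : CompleteSpace f.range := hrc.completeSpace_coe
    rw [← Submodule.orthogonal_eq_bot_iff, Submodule.eq_bot_iff]
    intro z hz
    rw [Submodule.mem_orthogonal'] at hz
    have hm : (z, -z) ∈ G := by
      rw [hG]
      intro u v huv
      have := hz (f ⟨(u, v), huv⟩) ⟨_, rfl⟩
      rw [hf, inner_add_right] at this
      rw [inner_neg_left]
      linarith
    have := hp _ _ hm
    rw [inner_neg_right, real_inner_self_eq_norm_sq] at this
    have : ‖z‖ = 0 := by nlinarith [norm_nonneg z]
    exact norm_eq_zero.mp this
  have hsurj : Function.Surjective f := LinearMap.range_eq_top.mp hrt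
  let e : G ≃ₗ[ℝ] E := LinearEquiv.ofBijective (f : G →ₗ[ℝ] E) ⟨hanti.injective, hsurj⟩
  have he : ∀ z, (e.symm z).1.1 + (e.symm z).1.2 = z := fun z => e.apply_symm_apply z
  let A0 : E →ₗ[ℝ] E := (LinearMap.fst ℝ E E).comp (G.subtype.comp (e.symm : E →ₗ[ℝ] G))
  let A : E →L[ℝ] E := A0.mkContinuous 1 (by
    intro z
    rw [one_mul]
    calc ‖A0 z‖ ≤ ‖e.symm z‖ := norm_fst_le _
      _ ≤ ‖f (e.symm z)‖ := hb _
      _ = ‖z‖ := by rw [show f (e.symm z) = z from e.apply_symm_apply z])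
  have hA : ∀ z, A z = (e.symm z).1.1 := fun z => rfl
  have hAG : ∀ z, (A z, z - A z) ∈ G := by
    intro z
    have : z - A z = (e.symm z).1.2 := by rw [hA, sub_eq_iff_eq_add']; exact (he z).symm
    rw [this]
    exact (e.symm z).2
  have hs : ∀ x y, ⟪A x, y⟫_ℝ = ⟪x, A y⟫_ℝ := by
    intro x y
    have := (hG _ _).1 (hAG x) _ _ (hAG y)
    rw [inner_sub_left, inner_sub_right] at this
    linarith
  have hpp : ∀ x, 0 ≤ ⟪A x, x⟫_ℝ - ⟪A x, A x⟫_ℝ := by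
    intro x
    have := hp _ _ (hAG x)
    rwa [inner_sub_right] at this
  refine ⟨A, ⟨hs, fun x => ?_⟩, ⟨fun x y => ?_, fun x => ?_⟩, fun x y => ⟨fun h => ?_, fun h => ?_⟩⟩
  · have := real_inner_self_nonneg (x := A x)
    linarith [hpp x]
  · simp [inner_sub_left, inner_sub_right, hs]
  · have h1 := real_inner_self_nonneg (x := x - A x)
    rw [inner_sub_sub_self] at h1
    simp only [_root_.sub_apply, one_apply_eq_self, inner_sub_left]
    have := real_inner_comm x (A x)
    linarith [hpp x]
  · rw [hA]
    have : e ⟨(x, y), h⟩ = x + y := rfl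
    rw [← this, LinearEquiv.symm_apply_apply]
  · have := hAG (x + y)
    rw [← h] at this
    simpa using this

lemma resolvent_comm {G : Submodule ℝ (E × E)} {A : E →L[ℝ] E}
    (hA : ∀ x y, (x, y) ∈ G ↔ x = A (x + y)) (B : E →L[ℝ] E)
    (hB : ∀ x y, (x, y) ∈ G → (B x, B y) ∈ G) : Commute B A := by
  refine ContinuousLinearMap.ext fun z => ?_
  have h1 : (A z, z - A z) ∈ G := by rw [hA]; simp
  have h2 := hB _ _ h1
  rw [hA, ← map_add] at h2
  simpa using h2

lemma root_unique [CompleteSpace E] {R Q S A : E →L[ℝ] E} (hR : RPos R) (hQ : RPos Q) (hS : RPos S)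
    (hQ1 : RPos (1 - Q)) (hS1 : RPos (1 - S))
    (hQQ : Q * Q = R) (hSS : S * S = 1 - R) (hQS : Commute Q S)
    (hcom : ∀ B : E →L[ℝ] E, Commute B R → Commute B Q ∧ Commute B S)
    (hA : RPos A) (hA1 : RPos (1 - A))
    (h : ∀ v, R (A (A v) + (1 - A) ((1 - A) v)) = A (A v)) :
    Q * (1 - A) = S * A := by
  set N : E →L[ℝ] E := A * A + (1 - A) * (1 - A) with hN
  have hNs : ∀ x y, ⟪N x, y⟫_ℝ = ⟪x, N y⟫_ℝ := by
    intro x y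
    simp only [hN, _root_.add_apply, mul_apply_eq_comp, inner_add_left,
      inner_add_right, hA.1, hA1.1]
  have hNi : ∀ x, N x = 0 → x = 0 := by
    intro x hx
    have h1 : ⟪N x, x⟫_ℝ = 0 := by rw [hx, inner_zero_left]
    simp only [hN, _root_.add_apply, mul_apply_eq_comp, inner_add_left] at h1
    rw [hA.1, hA1.1] at h1
    have p1 := real_inner_self_nonneg (x := A x)
    have p2 := real_inner_self_nonneg (x := (1 - A) x)
    have q1 : A x = 0 := inner_self_eq_zero (𝕜 := ℝ).mp (by linarith)
    have q2 : (1 - A) x = 0 := inner_self_eq_zero (𝕜 := ℝ).mp (by linarith)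
    simpa [q1] using q2
  have hRN : R * N = A * A := ContinuousLinearMap.ext h
  have hNR : N * R = A * A := by
    refine ContinuousLinearMap.ext fun x => ext_inner_right ℝ fun y => ?_
    have := DFunLike.congr_fun hRN y
    simp only [mul_apply_eq_comp] at this ⊢
    rw [hNs, hR.1, this, hA.1, hA.1]
  have cancel : ∀ X Y : E →L[ℝ] E, N * X = N * Y → X = Y := by
    intro X Y hXY
    ext x
    have := DFunLike.congr_fun hXY x
    simp only [mul_apply_eq_comp] at this
    rw [← sub_eq_zero, ← map_sub] at this
    exact sub_eq_zero.mp (hNi _ this)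
  have hNA : N * A = A * N := by rw [hN]; noncomm_ring
  have hAR : Commute A R := by
    refine cancel _ _ ?_
    rw [← mul_assoc, ← mul_assoc, hNR, hNA, mul_assoc, hNR]
    noncomm_ring
  obtain ⟨hAQ, hAS⟩ := hcom A hAR
  have h1Q : Commute (1 - A) Q := (Commute.one_left Q).sub_left hAQ
  have h1S : Commute (1 - A) S := (Commute.one_left S).sub_left hAS
  have hA1A : Commute (1 - A) A := (Commute.one_left A).sub_left (Commute.refl A)
  refine rpos_unique (rpos_mul hQ hQ1 hA1 h1Q) (rpos_mul hS hS1 hA hAS) ?_ ?_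
  · exact (hQS.mul_right hAQ.symm).mul_left (h1S.mul_right hA1A)
  · have e1 : Q * (1 - A) * (Q * (1 - A)) = R * ((1 - A) * (1 - A)) := by
      rw [h1Q.mul_mul_mul_comm, hQQ]
    have e2 : S * A * (S * A) = (1 - R) * (A * A) := by
      rw [hAS.mul_mul_mul_comm, hSS]
    rw [e1, e2]
    refine cancel _ _ ?_
    rw [← mul_assoc, hNR, ← mul_assoc N (1 - R), mul_sub N 1 R, hNR, hN]
    noncomm_ring

end RealPart

/-- The real Hilbert space underlying a quaternionic Hilbert space. -/
@[reducible]
def qReal (inn : H → H → ℍ) (hinn : QInner inn) : InnerProductSpace ℝ H :=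
  letI : Module ℝ H := Module.compHom H (algebraMap ℝ ℍᵐᵒᵖ)
  have hsm : ∀ (r : ℝ) (x : H), r • x = op (r : ℍ) • x := fun r x => rfl
  have hsr : ∀ (r : ℝ) (x y : H), inn x (r • y) = inn x y * (r : ℍ) := fun r x y => by
    rw [hsm, hinn.smul_right]
  have hsl : ∀ (r : ℝ) (x y : H), inn (r • x) y = (r : ℍ) * inn x y := fun r x y => by
    rw [hinn.conj_symm, hsr, star_mul, ← hinn.conj_symm]; simp
  { norm_smul_le := fun r x => by
      have h1 := hinn.norm_sq (r • x)
      rw [hsr, hsl, hinn.norm_sq, ← Quaternion.coe_mul, ← Quaternion.coe_mul] at h1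
      have h2 := Quaternion.coe_injective h1
      refine le_of_sq_le_sq ?_ (by positivity)
      rw [← h2, mul_pow, Real.norm_eq_abs, sq_abs]
      apply le_of_eq; ring
    inner := fun x y => (inn x y).re
    norm_sq_eq_re_inner := fun x => by
      simp only [RCLike.re_to_real]
      rw [hinn.norm_sq, Quaternion.re_coe]
    conj_inner_symm := fun x y => by
      rw [hinn.conj_symm x y]; simp
    add_left := fun x y z => by
      rw [hinn.conj_symm, hinn.add_right, star_add, ← hinn.conj_symm, ← hinn.conj_symm]
      simp
    smul_left := fun x y r => by
      rw [hsl]; simp }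

section QPart

variable [InnerProductSpace ℝ H] {inn : H → H → ℍ}

lemma inn_eq_of_re (hinn : QInner inn) (hi : ∀ x y : H, ⟪x, y⟫_ℝ = (inn x y).re)
    {x y u v : H} (h : ∀ q : ℍ, ⟪x, op q • v⟫_ℝ = ⟪y, op q • u⟫_ℝ) : inn x v = inn y u := by
  have h' : ∀ q : ℍ, ((inn x v - inn y u) * q).re = 0 := by
    intro q
    have := h q
    rw [hi, hi, hinn.smul_right, hinn.smul_right] at this
    rw [sub_mul, Quaternion.re_sub, this, sub_self]
  have := h' (star (inn x v - inn y u))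
  rw [Quaternion.self_mul_star, Quaternion.re_coe, Quaternion.normSq_eq_zero] at this
  exact sub_eq_zero.mp this

/-- The graph as a real subspace. -/
def rGraph (hsm : ∀ (r : ℝ) (x : H), r • x = op (r : ℍ) • x) (T : H →ₗ.[ℍᵐᵒᵖ] H) :
    Submodule ℝ (H × H) where
  carrier := {p | p ∈ T.graph}
  add_mem' := fun h h' => T.graph.add_mem h h'
  zero_mem' := T.graph.zero_mem
  smul_mem' := fun r p h => by
    have e : r • p = op (r : ℍ) • p := Prod.ext (hsm _ _) (hsm _ _)
    rw [e]
    exact T.graph.smul_mem _ h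

lemma mem_rGraph (hsm : ∀ (r : ℝ) (x : H), r • x = op (r : ℍ) • x) (T : H →ₗ.[ℍᵐᵒᵖ] H)
    (p : H × H) : p ∈ rGraph hsm T ↔ p ∈ T.graph := Iff.rfl

lemma graph_iff (T : H →ₗ.[ℍᵐᵒᵖ] H) (x y : H) :
    (x, y) ∈ T.graph ↔ ∃ h : x ∈ T.domain, T ⟨x, h⟩ = y := by
  rw [LinearPMap.mem_graph_iff]
  constructor
  · rintro ⟨⟨z, hz⟩, h1, h2⟩
    dsimp only at h1
    subst h1
    exact ⟨hz, h2⟩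
  · rintro ⟨h, rfl⟩
    exact ⟨⟨x, h⟩, rfl, rfl⟩

lemma mem_graph_op (T : H →ₗ.[ℍᵐᵒᵖ] H) {x y : H} (h : (x, y) ∈ T.graph) (q : ℍᵐᵒᵖ) :
    (q • x, q • y) ∈ T.graph := T.graph.smul_mem q h

lemma graph_symm {T : H →ₗ.[ℍᵐᵒᵖ] H} (hpos : IsPosP inn T) {x y u v : H}
    (h : (x, y) ∈ T.graph) (h' : (u, v) ∈ T.graph) : inn x v = inn y u := by
  rw [graph_iff] at h h'
  obtain ⟨hx, rfl⟩ := h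
  obtain ⟨hu, rfl⟩ := h'
  exact hpos.1.1 ⟨x, hx⟩ ⟨u, hu⟩

lemma graph_selfadj (hinn : QInner inn) (hi : ∀ x y : H, ⟪x, y⟫_ℝ = (inn x y).re)
    {T : H →ₗ.[ℍᵐᵒᵖ] H} (hd : Dense (T.domain : Set H)) (hpos : IsPosP inn T) (x y : H) :
    (x, y) ∈ T.graph ↔ ∀ u v, (u, v) ∈ T.graph → ⟪x, v⟫_ℝ = ⟪y, u⟫_ℝ := by
  constructor
  · intro h u v h'
    rw [hi, hi, graph_symm hpos h h']
  · intro h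
    have h2 : ∀ u v, (u, v) ∈ T.graph → inn x v = inn y u := fun u v huv =>
      inn_eq_of_re hinn hi fun q => h _ _ (mem_graph_op T huv _)
    have hx : x ∈ T.domain := hpos.1.2 x y fun u =>
      h2 _ _ ((graph_iff _ _ _).2 ⟨u.2, rfl⟩)
    rw [graph_iff]
    refine ⟨hx, ?_⟩
    refine sub_eq_zero.mp (hd.eq_zero_of_inner_left (𝕜 := ℝ) fun u hu => ?_)
    have h3 : (u, T ⟨u, hu⟩) ∈ T.graph := (graph_iff _ _ _).2 ⟨hu, rfl⟩
    rw [inner_sub_left, hi, hi, ← h2 _ _ h3,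
      graph_symm hpos ((graph_iff _ _ _).2 ⟨hx, rfl⟩) h3, sub_self]

lemma graph_pos (hi : ∀ x y : H, ⟪x, y⟫_ℝ = (inn x y).re)
    {T : H →ₗ.[ℍᵐᵒᵖ] H} (hpos : IsPosP inn T) (x y : H) (h : (x, y) ∈ T.graph) :
    0 ≤ ⟪x, y⟫_ℝ := by
  rw [graph_iff] at h
  obtain ⟨hx, rfl⟩ := h
  obtain ⟨r, hr, e⟩ := hpos.2 ⟨x, hx⟩
  rw [hi, e, Quaternion.re_coe]
  exact hr

lemma isPosP_of_graph (hinn : QInner inn) (hi : ∀ x y : H, ⟪x, y⟫_ℝ = (inn x y).re)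
    {C : H →ₗ.[ℍᵐᵒᵖ] H}
    (hs : ∀ x y, (x, y) ∈ C.graph ↔ ∀ u v, (u, v) ∈ C.graph → ⟪x, v⟫_ℝ = ⟪y, u⟫_ℝ)
    (hp : ∀ x y, (x, y) ∈ C.graph → 0 ≤ ⟪x, y⟫_ℝ) : IsPosP inn C := by
  have hg : ∀ x : C.domain, ((x : H), C x) ∈ C.graph := fun x =>
    (graph_iff _ _ _).2 ⟨x.2, rfl⟩
  have h1 : ∀ x y : C.domain, inn (x : H) (C y) = inn (C x) (y : H) := fun x y =>
    inn_eq_of_re hinn hi fun q => (hs _ _).1 (hg x) _ _ (mem_graph_op C (hg y) _)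
  refine ⟨⟨h1, fun x z h => ?_⟩, fun x => ⟨⟪(x : H), C x⟫_ℝ, hp _ _ (hg x), ?_⟩⟩
  · have : (x, z) ∈ C.graph := by
      rw [hs]
      intro u v huv
      obtain ⟨hu, rfl⟩ := (graph_iff _ _ _).1 huv
      rw [hi, hi, h ⟨u, hu⟩]
    exact ((graph_iff _ _ _).1 this).1
  · rw [hi]
    have h2 : inn (x : H) (C x) = star (inn (x : H) (C x)) := by
      rw [← hinn.conj_symm, h1]
    exact (Quaternion.star_eq_self.mp h2.symm)

lemma isCompP_iff (C T : H →ₗ.[ℍᵐᵒᵖ] H) : IsCompP C C T ↔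
    ∀ x y, (x, y) ∈ T.graph ↔ ∃ z, (x, z) ∈ C.graph ∧ (z, y) ∈ C.graph := by
  simp only [graph_iff]
  constructor
  · rintro ⟨h1, h2⟩ x y
    constructor
    · rintro ⟨hx, rfl⟩
      obtain ⟨ha, hb⟩ := (h1 x).1 hx
      exact ⟨_, ⟨ha, rfl⟩, hb, (h2 ⟨x, hx⟩ ha hb).symm⟩
    · rintro ⟨z, ⟨ha, rfl⟩, hb, rfl⟩
      have hx := (h1 x).2 ⟨ha, hb⟩
      exact ⟨hx, h2 ⟨x, hx⟩ ha hb⟩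
  · intro h
    refine ⟨fun x => ⟨fun hx => ?_, fun ⟨ha, hb⟩ => ?_⟩, fun x ha hb => ?_⟩
    · obtain ⟨z, ⟨ha, rfl⟩, hb, _⟩ := (h x _).1 ⟨hx, rfl⟩
      exact ⟨ha, hb⟩
    · exact ((h x _).2 ⟨_, ⟨ha, rfl⟩, hb, rfl⟩).1
    · obtain ⟨_, e⟩ := (h x _).2 ⟨_, ⟨ha, rfl⟩, hb, rfl⟩
      exact e

lemma commP_iff (B : H →L[ℍᵐᵒᵖ] H) (T : H →ₗ.[ℍᵐᵒᵖ] H) : CommP B T ↔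
    ∀ x y, (x, y) ∈ T.graph → (B x, B y) ∈ T.graph := by
  simp only [graph_iff]
  constructor
  · rintro h x y ⟨hx, rfl⟩
    exact h ⟨x, hx⟩
  · intro h x
    exact h x _ ⟨x.2, rfl⟩

/-- Right multiplication by a quaternion as a real bounded operator. -/
def rMul (inn : H → H → ℍ) (hinn : QInner inn)
    (hsm : ∀ (r : ℝ) (x : H), r • x = op (r : ℍ) • x) (q : ℍ) : H →L[ℝ] H :=
  LinearMap.mkContinuous
    { toFun := fun x => op q • x
      map_add' := fun x y => smul_add _ _ _
      map_smul' := fun r x => by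
        rw [RingHom.id_apply, hsm, hsm, smul_smul, smul_smul, ← op_mul, ← op_mul,
          (Quaternion.coe_commutes r q)] } ‖q‖ (by
    intro x
    have h1 := hinn.norm_sq (op q • x)
    rw [hinn.smul_right, hinn.conj_symm, hinn.smul_right, hinn.norm_sq, star_mul,
      Quaternion.star_coe, mul_assoc] at h1
    rw [Quaternion.coe_commutes, ← mul_assoc, Quaternion.star_mul_self, ← Quaternion.coe_mul,
      Quaternion.normSq_eq_norm_mul_self] at h1
    have h2 := Quaternion.coe_injective h1
    refine le_of_sq_le_sq ?_ (by positivity)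
    change ‖op q • x‖ ^ 2 ≤ _
    rw [← h2]
    apply le_of_eq; ring)

lemma rMul_apply (hinn : QInner inn)
    (hsm : ∀ (r : ℝ) (x : H), r • x = op (r : ℍ) • x) (q : ℍ) (x : H) :
    rMul inn hinn hsm q x = op q • x := rfl

/-- A bounded quaternionic operator as a real bounded operator. -/
def rOp (hsm : ∀ (r : ℝ) (x : H), r • x = op (r : ℍ) • x) (B : H →L[ℍᵐᵒᵖ] H) : H →L[ℝ] H where
  toFun := B
  map_add' := map_add B
  map_smul' := fun r x => by rw [hsm, hsm, map_smul]; rfl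
  cont := B.continuous

lemma rOp_apply (hsm : ∀ (r : ℝ) (x : H), r • x = op (r : ℍ) • x) (B : H →L[ℍᵐᵒᵖ] H) (x : H) :
    rOp hsm B x = B x := rfl

lemma main_aux [CompleteSpace H] (hinn : QInner inn)
    (hi : ∀ x y : H, ⟪x, y⟫_ℝ = (inn x y).re)
    (hsm : ∀ (r : ℝ) (x : H), r • x = op (r : ℍ) • x)
    (T : H →ₗ.[ℍᵐᵒᵖ] H)
    (hdense : Dense (T.domain : Set H))
    (hpos : IsPosP inn T) :
    ∃ C : H →ₗ.[ℍᵐᵒᵖ] H,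
      (IsPosP inn C ∧ IsCompP C C T) ∧
      (∀ B : H →L[ℍᵐᵒᵖ] H, CommP B T → CommP B C) ∧
      ∀ C' : H →ₗ.[ℍᵐᵒᵖ] H, IsPosP inn C' ∧ IsCompP C' C' T → C' = C := by
  obtain ⟨R, hR, hR1, hRG⟩ := rel_resolvent (rGraph hsm T)
    (graph_selfadj hinn hi hdense hpos) (graph_pos hi hpos)
  have hTG : ∀ x y, (x, y) ∈ T.graph ↔ x = R (x + y) := hRG
  obtain ⟨Q, S, hQ, hS, hQ1, hS1, hQQ, hSS, hQS, hQSp, hcom⟩ := real_roots hR hR1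
  have hq : ∀ q : ℍ, Commute (rMul inn hinn hsm q) R := fun q =>
    resolvent_comm hRG _ fun x y h => mem_graph_op T h _
  have hQq : ∀ (q : ℍᵐᵒᵖ) x, Q (q • x) = q • Q x := fun q x =>
    (DFunLike.congr_fun (hcom _ (hq (unop q))).1 x).symm
  have hSq : ∀ (q : ℍᵐᵒᵖ) x, S (q • x) = q • S x := fun q x =>
    (DFunLike.congr_fun (hcom _ (hq (unop q))).2 x).symm
  have hQQ' : ∀ x, Q (Q x) = R x := fun x => DFunLike.congr_fun hQQ x
  have hSS' : ∀ x, S (S x) = x - R x := fun x => DFunLike.congr_fun hSS x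
  have hQS' : ∀ x, Q (S x) = S (Q x) := fun x => DFunLike.congr_fun hQS x
  have hQinj : ∀ y, Q y = 0 → y = 0 := by
    intro y hy
    have h1 : R y = 0 := by rw [← hQQ', hy, map_zero]
    have h2 : ((0 : H), y) ∈ T.graph := by rw [hTG, zero_add, h1]
    exact T.graph_fst_eq_zero_snd h2 rfl
  let g : Submodule ℍᵐᵒᵖ (H × H) :=
    { carrier := {p | Q p.2 = S p.1}
      add_mem' := by
        intro a b ha hb
        change Q (a.2 + b.2) = S (a.1 + b.1)
        rw [map_add, map_add, show Q a.2 = S a.1 from ha, show Q b.2 = S b.1 from hb]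
      zero_mem' := by
        change Q 0 = S 0
        rw [map_zero, map_zero]
      smul_mem' := by
        intro q a ha
        change Q (q • a.2) = S (q • a.1)
        rw [hQq, hSq, show Q a.2 = S a.1 from ha] }
  have hg : ∀ x y, (x, y) ∈ g ↔ Q y = S x := fun x y => Iff.rfl
  have hgs : ∀ p ∈ g, p.1 = 0 → p.2 = 0 := by
    rintro ⟨x, y⟩ h (rfl : x = 0)
    rw [hg, map_zero] at h
    exact hQinj _ h
  let C : H →ₗ.[ℍᵐᵒᵖ] H := g.toLinearPMap
  have hC : ∀ x y, (x, y) ∈ C.graph ↔ Q y = S x := by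
    intro x y
    rw [← hg, show C.graph = g from g.toLinearPMap_graph_eq hgs]
  have hpar : ∀ x y, Q y = S x → ∃ z, x = Q z ∧ y = S z := by
    intro x y h
    refine ⟨Q x + S y, ?_, ?_⟩
    · rw [map_add, hQQ', hQS', h, hSS']; abel
    · rw [map_add, ← hQS', ← h, hQQ', hSS']; abel
  have hCs : ∀ x y, (x, y) ∈ C.graph ↔ ∀ u v, (u, v) ∈ C.graph → ⟪x, v⟫_ℝ = ⟪y, u⟫_ℝ := by
    intro x y
    constructor
    · intro h u v h'
      rw [hC] at h h'
      obtain ⟨w, rfl, rfl⟩ := hpar _ _ h'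
      rw [← hQ.1, ← hS.1, h]
    · intro h
      rw [hC]
      refine ext_inner_right ℝ fun w => ?_
      rw [hQ.1, hS.1]
      exact (h (Q w) (S w) ((hC _ _).2 (hQS' w))).symm
  have hCp : ∀ x y, (x, y) ∈ C.graph → 0 ≤ ⟪x, y⟫_ℝ := by
    intro x y h
    obtain ⟨z, rfl, rfl⟩ := hpar _ _ ((hC _ _).1 h)
    have := hQSp.2 z
    rw [mul_apply_eq_comp, hQ.1, real_inner_comm] at this
    exact this
  refine ⟨C, ⟨isPosP_of_graph hinn hi hCs hCp, ?_⟩, fun B hB => ?_, ?_⟩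
  · rw [isCompP_iff]
    intro x y
    simp only [hC]
    rw [hTG]
    constructor
    · intro h
      refine ⟨Q (S (x + y)), ?_, ?_⟩
      · rw [hQQ']
        conv_rhs => rw [h, ← hQQ']
        rw [← hQS', ← hQS', hQQ']
      · have : y = S (S (x + y)) := by rw [hSS', ← h]; abel
        conv_lhs => rw [this]
        rw [hQS']
    · rintro ⟨z, h1, h2⟩
      obtain ⟨w, rfl, rfl⟩ := hpar _ _ h1
      rw [hSS', ← hQQ'] at h2
      have h3 : w = Q (Q w + y) := by rw [map_add, h2]; abel
      rw [← hQQ', ← h3]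
  · rw [commP_iff] at hB ⊢
    have hc := hcom _ (resolvent_comm hRG (rOp hsm B) hB)
    have h1 : ∀ x, B (Q x) = Q (B x) := fun x => DFunLike.congr_fun hc.1 x
    have h2 : ∀ x, B (S x) = S (B x) := fun x => DFunLike.congr_fun hc.2 x
    intro x y h
    rw [hC] at h ⊢
    rw [← h1, ← h2, h]
  · rintro C' ⟨hC'p, hC'c⟩
    have hd' : Dense (C'.domain : Set H) :=
      hdense.mono fun x hx => ((hC'c.1 x).1 hx).1
    rw [isCompP_iff] at hC'c
    have hs' := graph_selfadj hinn hi hd' hC'p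
    obtain ⟨A, hA, hA1, hAG⟩ := rel_resolvent (rGraph hsm C') hs' (graph_pos hi hC'p)
    have hAG' : ∀ x y, (x, y) ∈ C'.graph ↔ x = A (x + y) := hAG
    have hAm : ∀ z, (A z, (1 - A) z) ∈ C'.graph := by
      intro z; rw [hAG']; simp
    have key : Q * (1 - A) = S * A := by
      refine root_unique hR hQ hS hQ1 hS1 hQQ hSS hQS hcom hA hA1 fun v => ?_
      refine ((hTG _ _).1 ((hC'c _ _).2 ⟨A ((1 - A) v), ?_, hAm _⟩)).symm
      have := hAm (A v)
      simpa using this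
    have hsub : ∀ x y, (x, y) ∈ C'.graph → (x, y) ∈ C.graph := by
      intro x y h
      have h1 := (hAG' x y).1 h
      have h2 : y = (1 - A) (x + y) := by
        rw [_root_.sub_apply, one_apply_eq_self, ← h1]; abel
      rw [hC]
      have := DFunLike.congr_fun key (x + y)
      rw [mul_apply_eq_comp, mul_apply_eq_comp, ← h1, ← h2] at this
      exact this
    apply LinearPMap.eq_of_eq_graph
    ext ⟨x, y⟩
    refine ⟨hsub x y, fun h => ?_⟩
    rw [hs']
    intro u v huv
    exact (hCs x y).1 h u v (hsub _ _ huv)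

end QPart

/-- every densely defined positive operator `T` has a unique positive
square root `C` (with `D(C²) = D(T)` and `C² = T`, encoded by `IsCompP C C T`),
and `C` commutes with every bounded operator commuting with `T`. -/
theorem positive_unique_square_root
    [CompleteSpace H] (inn : H → H → ℍ) (hinn : QInner inn)
    (T : H →ₗ.[ℍᵐᵒᵖ] H)
    (hdense : Dense (T.domain : Set H))
    (hpos : IsPosP inn T) :
    ∃ C : H →ₗ.[ℍᵐᵒᵖ] H,
      (IsPosP inn C ∧ IsCompP C C T) ∧
      (∀ B : H →L[ℍᵐᵒᵖ] H, CommP B T → CommP B C) ∧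
      ∀ C' : H →ₗ.[ℍᵐᵒᵖ] H, IsPosP inn C' ∧ IsCompP C' C' T → C' = C := by
  let _ := qReal inn hinn
  exact main_aux hinn (fun x y => rfl) (fun r x => rfl) T hdense hpos
end
end

section
/- For any densely defined closed right linear operator T in a quaternionic Hilbert space, T*T is a positive operator, i.e. ⟨x | T*Tx⟩ ≥ 0 for all x ∈ D(T*T), and hence T*T admits a unique positive square root |T|. -/
noncomputable section

open MulOpposite

local notation "ℍ" => Quaternion ℝ

variable {H : Type*} [NormedAddCommGroup H] [Module ℍᵐᵒᵖ H]

section CX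
variable {E : Type*} [NormedAddCommGroup E] [InnerProductSpace ℂ E] [CompleteSpace E]

open ComplexConjugate in
theorem cx_J_comm (A : E →L[ℂ] E) (hA : 0 ≤ A) (J : E → E)
    (hadd : ∀ x y, J (x + y) = J x + J y) (hsmul : ∀ (c : ℂ) x, J (c • x) = conj c • J x)
    (hin : ∀ x y, inner ℂ (J x) (J y) = conj (inner ℂ x y)) (hJJ : ∀ x, J (J x) = - x)
    (hAJ : ∀ x, A (A (J x)) = J (A (A x))) (x : E) : A (J x) = J (A x) := by
  have hneg : ∀ x, J (-x) = - J x := fun x => by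
    have := hsmul (-1) x
    simpa using this
  have hin' : ∀ x y, inner ℂ x (J y) = - conj (inner ℂ (J x) y) := fun x y => by
    have := hin (J x) y
    rw [hJJ, inner_neg_left] at this
    rw [← this, neg_neg]
  have hin2 : ∀ x y, inner ℂ (J x) y = - conj (inner ℂ x (J y)) := fun x y => by
    rw [hin']; simp
  have hP := (ContinuousLinearMap.nonneg_iff_isPositive A).1 hA
  let L : E →ₗ[ℂ] E :=
    { toFun := fun x => - J (A (J x))
      map_add' := fun x y => by simp [hadd]; abel
      map_smul' := fun c x => by simp [hsmul] }
  have hL : ∀ x, L x = - J (A (J x)) := fun _ => rfl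
  have hLs : L.IsSymmetric := fun x y => by
    rw [hL, hL, inner_neg_left, inner_neg_right, hin2, hin' x, neg_neg, neg_neg,
      hP.inner_left_eq_inner_right]
  let A' : E →L[ℂ] E := ⟨L, hLs.continuous⟩
  have hA' : ∀ x, A' x = - J (A (J x)) := fun _ => rfl
  have hA'0 : 0 ≤ A' := by
    rw [ContinuousLinearMap.nonneg_iff_isPositive]
    refine ⟨hLs, fun x => ?_⟩
    change 0 ≤ RCLike.re (inner ℂ (A' x) x)
    rw [hA', inner_neg_left, hin2, neg_neg]
    have := hP.re_inner_nonneg_left (J x)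
    rw [hP.inner_left_eq_inner_right] at this
    simpa using this
  have h1 : A' * A' = A * A := by
    ext x
    simp only [mul_apply_eq_comp, hA', hneg, hJJ, neg_neg]
    rw [hAJ, hJJ, neg_neg]
  have h2 : A' = A := by
    rw [← CFC.sqrt_mul_self A' hA'0, h1, CFC.sqrt_mul_self A hA]
  have := hA' x
  rw [h2] at this
  rw [this, hneg, hJJ, neg_neg]

theorem cx_sqrt (R : E →L[ℂ] E) (h0 : 0 ≤ R) (h1 : R ≤ 1) :
    ∃ A B : E →L[ℂ] E, 0 ≤ A ∧ 0 ≤ B ∧ A * A = R ∧ B * B = 1 - R ∧ A * B = B * A ∧ 0 ≤ A * B ∧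
      ∀ G : E →L[ℂ] E, 0 ≤ G → G * G = R - R * R → G = A * B := by
  have h1' : 0 ≤ 1 - R := sub_nonneg.2 h1
  set A := CFC.sqrt R with hA
  set B := CFC.sqrt (1 - R) with hB
  have hA2 : A * A = R := CFC.sqrt_mul_sqrt_self R h0
  have hB2 : B * B = 1 - R := CFC.sqrt_mul_sqrt_self _ h1'
  have c1 : Commute R A := by rw [← hA2]; exact (Commute.refl A).mul_left (Commute.refl A)
  have c2 : Commute (1 - R) A := (Commute.one_left A).sub_left c1
  have c3 : Commute B A := by
    rw [hB, CFC.sqrt]; exact Commute.cfcₙ_nnreal c2 _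
  have hA0 : 0 ≤ A := CFC.sqrt_nonneg _
  have hB0 : 0 ≤ B := CFC.sqrt_nonneg _
  have hAB : 0 ≤ A * B := c3.symm.mul_nonneg hA0 hB0
  refine ⟨A, B, hA0, hB0, hA2, hB2, c3.eq.symm, hAB, fun G hG hGG => ?_⟩
  rw [← CFC.sqrt_mul_self G hG, ← CFC.sqrt_mul_self (A * B) hAB, hGG]
  congr 1
  calc R - R * R = R * (1 - R) := by noncomm_ring
    _ = A * (A * B) * B := by rw [← hB2, ← hA2]; noncomm_ring
    _ = A * B * (A * B) := by 
      simp only [mul_assoc]; congr 1; rw [← mul_assoc, ← mul_assoc, c3.eq.symm]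

theorem cx_proj (K : Submodule ℂ (E × E)) (hK : IsClosed (K : Set (E × E))) (w : E) :
    ∃ p ∈ K, ∀ q ∈ K, inner ℂ (w - p.1) q.1 = inner ℂ p.2 q.2 := by
  let e := WithLp.prodContinuousLinearEquiv 2 ℂ E E
  let K' : Submodule ℂ (WithLp 2 (E × E)) := K.comap (e : WithLp 2 (E × E) →ₗ[ℂ] E × E)
  have hK' : IsClosed (K' : Set (WithLp 2 (E × E))) := hK.preimage e.continuous
  have : CompleteSpace K' := hK'.completeSpace_coe
  refine ⟨e (K'.starProjection (WithLp.toLp 2 (w, 0))), K'.starProjection_apply_mem _, fun q hq => ?_⟩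
  have := K'.starProjection_inner_eq_zero (WithLp.toLp 2 (w, 0)) (WithLp.toLp 2 q) hq
  rw [WithLp.prod_inner_apply] at this
  simp only [WithLp.ofLp_sub, Prod.fst_sub, Prod.snd_sub, zero_sub, inner_neg_left] at this
  exact add_neg_eq_zero.1 this
end CX

section QL

/-- The quaternion with given coordinates. -/
def qmk (a b c d : ℝ) : ℍ := ⟨a, b, c, d⟩

@[simp] theorem qmk_re (a b c d : ℝ) : (qmk a b c d).re = a := rfl
@[simp] theorem qmk_imI (a b c d : ℝ) : (qmk a b c d).imI = b := rfl
@[simp] theorem qmk_imJ (a b c d : ℝ) : (qmk a b c d).imJ = c := rfl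
@[simp] theorem qmk_imK (a b c d : ℝ) : (qmk a b c d).imK = d := rfl

/-- The embedding of `ℂ` into `ℍᵐᵒᵖ`. -/
def qcx : ℂ →+* ℍᵐᵒᵖ where
  toFun z := op (qmk z.re z.im 0 0)
  map_one' := by rw [← op_one]; congr 1
  map_zero' := by rw [← op_zero]; congr 1
  map_mul' z w := by
    rw [← op_mul]; congr 1
    apply Quaternion.ext <;> simp <;> ring
  map_add' z w := by rw [← op_add]; congr 1; apply Quaternion.ext <;> simp

theorem QInner.add_left {inn : H → H → ℍ} (h : QInner inn) (u v w : H) :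
    inn (u + v) w = inn u w + inn v w := by
  rw [h.conj_symm, h.add_right, star_add, ← h.conj_symm, ← h.conj_symm]

theorem QInner.smul_left {inn : H → H → ℍ} (h : QInner inn) (u v : H) (q : ℍ) :
    inn (op q • u) v = star q * inn u v := by
  rw [h.conj_symm, h.smul_right, star_mul, ← h.conj_symm]

theorem QInner.zero_right {inn : H → H → ℍ} (h : QInner inn) (u : H) : inn u 0 = 0 := by
  have := h.smul_right u 0 0
  simpa using this

theorem QInner.neg_right {inn : H → H → ℍ} (h : QInner inn) (u v : H) :
    inn u (-v) = - inn u v := by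
  have := h.smul_right u v (-1)
  simpa using this

theorem QInner.sub_right {inn : H → H → ℍ} (h : QInner inn) (u v w : H) :
    inn u (v - w) = inn u v - inn u w := by
  rw [sub_eq_add_neg, h.add_right, h.neg_right, sub_eq_add_neg]

theorem QInner.sub_left {inn : H → H → ℍ} (h : QInner inn) (u v w : H) :
    inn (u - v) w = inn u w - inn v w := by
  rw [h.conj_symm, h.sub_right, star_sub, ← h.conj_symm, ← h.conj_symm]

theorem QInner.re_self {inn : H → H → ℍ} (h : QInner inn) (u : H) :
    (inn u u).re = ‖u‖ ^ 2 := by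
  rw [h.norm_sq, Quaternion.re_coe]

theorem QInner.re_symm {inn : H → H → ℍ} (h : QInner inn) (u v : H) :
    (inn u v).re = (inn v u).re := by
  rw [h.conj_symm]; simp

theorem QInner.ext_left {inn : H → H → ℍ} (h : QInner inn) {a b : H}
    (hab : ∀ z, inn a z = inn b z) : a = b := by
  have h1 : inn (a - b) (a - b) = 0 := by rw [h.sub_left, hab, sub_self]
  have h2 := h.re_self (a - b)
  rw [h1] at h2
  have h3 : ‖a - b‖ = 0 := by
    have : ‖a - b‖ ^ 2 = 0 := by rw [← h2, Quaternion.re_zero]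
    exact pow_eq_zero_iff (two_ne_zero) |>.1 this
  exact sub_eq_zero.1 (norm_eq_zero.1 h3)

theorem QInner.real_of {inn : H → H → ℍ} (h : QInner inn) {x y : H}
    (hxy : inn x y = inn y x) : inn x y = ((inn x y).re : ℍ) := by
  have h1 := h.conj_symm x y
  rw [← hxy] at h1
  have hI := congrArg QuaternionAlgebra.imI h1
  have hJ := congrArg QuaternionAlgebra.imJ h1
  have hK := congrArg QuaternionAlgebra.imK h1
  simp at hI hJ hK
  apply Quaternion.ext <;> simp <;> linarith

theorem q_eq_of_re {a b : ℍ} (h : ∀ q : ℍ, (a * q).re = (b * q).re) : a = b := by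
  have h1 := h 1
  have h2 := h (qmk 0 1 0 0)
  have h3 := h (qmk 0 0 1 0)
  have h4 := h (qmk 0 0 0 1)
  simp at h1 h2 h3 h4
  apply Quaternion.ext <;> assumption

/-- The complex inner product space underlying a quaternionic one. -/
@[reducible] def qIPS {inn : H → H → ℍ} (h : QInner inn) : InnerProductSpace ℂ H :=
  letI : Module ℂ H := Module.compHom H qcx
  have hsm : ∀ (c : ℂ) (x : H), c • x = op (qmk c.re c.im 0 0) • x := fun _ _ => rfl
  letI : NormedSpace ℂ H :=
    { norm_smul_le := fun c x => by
        apply le_of_eq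
        rw [← sq_eq_sq₀ (norm_nonneg _) (by positivity), mul_pow, ← h.re_self, ← h.re_self, hsm,
          h.smul_right, h.smul_left, h.norm_sq, Complex.sq_norm, Complex.normSq_apply]
        simp
        ring }
  { inner := fun x y => ⟨(inn x y).re, (inn x y).imI⟩
    norm_sq_eq_re_inner := fun x => by
      change _ = (inn x x).re
      rw [h.re_self]
    conj_inner_symm := fun x y => by
      rw [h.conj_symm x y]
      apply Complex.ext <;> simp
    add_left := fun x y z => by
      rw [h.add_left]
      apply Complex.ext <;> simp
    smul_left := fun x y r => by
      rw [hsm, h.smul_left]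
      apply Complex.ext <;> simp }

theorem q_sqrt [CompleteSpace H] {inn : H → H → ℍ} (h : QInner inn) (R : H →ₗ[ℍᵐᵒᵖ] H)
    (hs : ∀ x y, inn (R x) y = inn x (R y)) (h0 : ∀ x, 0 ≤ (inn x (R x)).re)
    (h1 : ∀ x, (inn x (R x)).re ≤ (inn x x).re) :
    ∃ A B : H →ₗ[ℍᵐᵒᵖ] H, (∀ x y, inn (A x) y = inn x (A y)) ∧ (∀ x y, inn (B x) y = inn x (B y)) ∧
      (∀ x, A (A x) = R x) ∧ (∀ x, B (B x) = x - R x) ∧ (∀ x, A (B x) = B (A x)) ∧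
      (∀ x, 0 ≤ (inn x (A (B x))).re) ∧
      ∀ G : H →ₗ[ℍᵐᵒᵖ] H, (∀ x y, inn (G x) y = inn x (G y)) → (∀ x, 0 ≤ (inn x (G x)).re) →
        (∀ x, G (G x) = R x - R (R x)) → ∀ x, G x = A (B x) := by
  let _ : InnerProductSpace ℂ H := qIPS h
  have hsm : ∀ (c : ℂ) (x : H), c • x = op (qmk c.re c.im 0 0) • x := fun _ _ => rfl
  have hin : ∀ x y : H, inner ℂ x y = (⟨(inn x y).re, (inn x y).imI⟩ : ℂ) := fun _ _ => rfl
  -- lift quaternionic symmetric operators to complex bounded ones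
  have lift : ∀ F : H →ₗ[ℍᵐᵒᵖ] H, (∀ x y, inn (F x) y = inn x (F y)) →
      ∃ F' : H →L[ℂ] H, (∀ x, F' x = F x) ∧ ((∀ x, 0 ≤ (inn x (F x)).re) → 0 ≤ F') := by
    intro F hF
    let L : H →ₗ[ℂ] H :=
      { toFun := F
        map_add' := F.map_add
        map_smul' := fun c x => by simp [hsm] }
    have hL : L.IsSymmetric := fun x y => by
      change inner ℂ (F x) y = inner ℂ x (F y)
      rw [hin, hin, hF]
    refine ⟨⟨L, hL.continuous⟩, fun _ => rfl, fun hp => ?_⟩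
    rw [ContinuousLinearMap.nonneg_iff_isPositive]
    refine ⟨hL, fun x => ?_⟩
    change 0 ≤ (inn (F x) x).re
    rw [h.re_symm]
    exact hp x
  let J : H → H := fun x => op (qmk 0 0 1 0) • x
  have hJ : ∀ x, J x = op (qmk 0 0 1 0) • x := fun _ => rfl
  have hgen : ∀ (q : ℍ) (x : H), op q • x =
      (⟨q.re, q.imI⟩ : ℂ) • x + (⟨q.imJ, - q.imK⟩ : ℂ) • J x := by
    intro q x
    rw [hsm, hsm, hJ, smul_smul, ← add_smul, ← op_mul, ← op_add]
    congr 2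
    apply Quaternion.ext <;> simp
  have desc : ∀ F : H →L[ℂ] H, 0 ≤ F → (∀ x, F (F (J x)) = J (F (F x))) →
      ∃ F' : H →ₗ[ℍᵐᵒᵖ] H, (∀ x, F' x = F x) ∧ (∀ x y, inn (F' x) y = inn x (F' y)) := by
    intro F hF hFJ
    have hc : ∀ x, F (J x) = J (F x) := by
      refine cx_J_comm F hF J (fun x y => smul_add _ _ _) ?_ ?_ ?_ hFJ
      · intro c x
        rw [hJ, hJ, hsm, hsm, smul_smul, smul_smul, ← op_mul, ← op_mul]
        congr 2
        apply Quaternion.ext <;> simp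
      · intro x y
        rw [hJ, hJ, hin, hin, h.smul_left, h.smul_right]
        apply Complex.ext <;> simp
      · intro x
        rw [hJ, hJ, smul_smul, ← op_mul, ← neg_one_smul ℍᵐᵒᵖ x]
        rw [← op_one, ← op_neg]
        congr 2
        apply Quaternion.ext <;> simp <;> rfl
    let F' : H →ₗ[ℍᵐᵒᵖ] H :=
      { toFun := F
        map_add' := fun x y => map_add F x y
        map_smul' := fun q x => by
          obtain ⟨q, rfl⟩ := op_surjective q
          simp only [RingHom.id_apply]
          rw [hgen, hgen, map_add, map_smul, map_smul, hc] }
    refine ⟨F', fun _ => rfl, fun x y => ?_⟩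
    apply q_eq_of_re
    intro q
    rw [← h.smul_right, ← h.smul_right, ← map_smul]
    have := ((ContinuousLinearMap.nonneg_iff_isPositive F).1 hF).inner_left_eq_inner_right
      x (op q • y)
    exact congrArg Complex.re this
  obtain ⟨R', hR', hRp⟩ := lift R hs
  have hR1 : R' ≤ 1 := by
    obtain ⟨S', hS', hSp⟩ := lift (LinearMap.id - R) (fun x y => by
      simp [h.sub_left, h.sub_right, hs])
    have : S' = 1 - R' := by ext x; simp [hS', hR']
    rw [← sub_nonneg, ← this]
    apply hSp
    intro x
    simp [h.sub_right, h1]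
  obtain ⟨A', B', hA0, hB0, hAA, hBB, hAB, hAB0, huniq⟩ := cx_sqrt R' (hRp h0) hR1
  have hAA' : ∀ x, A' (A' x) = R x := fun x => by rw [← hR', ← hAA]; rfl
  have hBB' : ∀ x, B' (B' x) = x - R x := fun x => by
    rw [← hR']; exact congrArg (fun F : H →L[ℂ] H => F x) hBB
  obtain ⟨A, hA, hAs⟩ := desc A' hA0 (fun x => by rw [hAA', hAA', hJ, map_smul])
  obtain ⟨B, hB, hBs⟩ := desc B' hB0 (fun x => by rw [hBB', hBB', hJ, hJ, map_smul, smul_sub])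
  refine ⟨A, B, hAs, hBs, fun x => by rw [hA, hA, hAA'], fun x => by rw [hB, hB, hBB'],
    fun x => ?_, fun x => ?_, fun G hGs hGp hGG x => ?_⟩
  · rw [hA, hB, hB, hA]; exact congrArg (fun F : H →L[ℂ] H => F x) hAB
  · have := ((ContinuousLinearMap.nonneg_iff_isPositive _).1 hAB0).re_inner_nonneg_right x
    rw [hA, hB]; exact this
  · obtain ⟨G', hG', hG'p⟩ := lift G hGs
    have := huniq G' (hG'p hGp) (by ext x; simp [hG', hGG, hR'])
    rw [hA, hB, ← hG', this]; rfl

theorem q_proj [CompleteSpace H] {inn : H → H → ℍ} (h : QInner inn)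
    (K : Submodule ℍᵐᵒᵖ (H × H)) (hK : IsClosed (K : Set (H × H))) (w : H) :
    ∃ p ∈ K, ∀ q ∈ K, inn (w - p.1) q.1 = inn p.2 q.2 := by
  let _ : InnerProductSpace ℂ H := qIPS h
  let K' : Submodule ℂ (H × H) :=
    { carrier := K
      add_mem' := K.add_mem
      zero_mem' := K.zero_mem
      smul_mem' := fun c x hx => K.smul_mem (qcx c) hx }
  obtain ⟨p, hp, hpq⟩ := cx_proj K' hK w
  refine ⟨p, hp, fun q hq => q_eq_of_re fun s => ?_⟩
  rw [← h.smul_right, ← h.smul_right]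
  exact congrArg Complex.re (hpq (op s • q) (K.smul_mem (op s) hq))

end QL

section Graphs

theorem adjG1 {inn : H → H → ℍ} {T S : H →ₗ.[ℍᵐᵒᵖ] H} (h : IsAdjP inn T S) {x x' y y' : H}
    (hx : (x, x') ∈ S.graph) (hy : (y, y') ∈ T.graph) : inn x y' = inn x' y := by
  rw [LinearPMap.mem_graph_iff] at hx hy
  obtain ⟨a, rfl, rfl⟩ := hx
  obtain ⟨b, rfl, rfl⟩ := hy
  exact h.1 a b

theorem adjG2 {inn : H → H → ℍ} {T S : H →ₗ.[ℍᵐᵒᵖ] H} (h : IsAdjP inn T S) {x z : H}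
    (hx : ∀ y y', (y, y') ∈ T.graph → inn x y' = inn z y) : ∃ x', (x, x') ∈ S.graph := by
  have := h.2 x z (fun y => hx _ _ (T.mem_graph y))
  exact ⟨S ⟨x, this⟩, S.mem_graph ⟨x, this⟩⟩

theorem adjG_of {inn : H → H → ℍ} {T S : H →ₗ.[ℍᵐᵒᵖ] H}
    (h1 : ∀ x x' y y', (x, x') ∈ S.graph → (y, y') ∈ T.graph → inn x y' = inn x' y)
    (h2 : ∀ x z, (∀ y y', (y, y') ∈ T.graph → inn x y' = inn z y) → ∃ x', (x, x') ∈ S.graph) :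
    IsAdjP inn T S := by
  refine ⟨fun x y => h1 _ _ _ _ (S.mem_graph x) (T.mem_graph y), fun x z hxz => ?_⟩
  rw [LinearPMap.mem_domain_iff]
  refine h2 x z fun y y' hy => ?_
  rw [LinearPMap.mem_graph_iff] at hy
  obtain ⟨b, rfl, rfl⟩ := hy
  exact hxz b

theorem compG {S T C : H →ₗ.[ℍᵐᵒᵖ] H} (h : IsCompP S T C) {x z : H} :
    (x, z) ∈ C.graph ↔ ∃ y, (x, y) ∈ T.graph ∧ (y, z) ∈ S.graph := by
  constructor
  · intro hx
    rw [LinearPMap.mem_graph_iff] at hx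
    obtain ⟨a, rfl, rfl⟩ := hx
    obtain ⟨h1, h2⟩ := (h.1 _).1 a.2
    refine ⟨_, T.mem_graph ⟨a, h1⟩, ?_⟩
    rw [h.2 a h1 h2]
    exact S.mem_graph ⟨_, h2⟩
  · rintro ⟨y, hx, hy⟩
    rw [LinearPMap.mem_graph_iff] at hx hy
    obtain ⟨a, rfl, rfl⟩ := hx
    obtain ⟨b, hb, rfl⟩ := hy
    obtain ⟨b, hb'⟩ := b
    simp only at hb
    subst hb
    have hd : (a : H) ∈ C.domain := (h.1 _).2 ⟨a.2, hb'⟩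
    have := h.2 ⟨a, hd⟩ a.2 hb'
    erw [← this]
    exact C.mem_graph ⟨a, hd⟩

theorem compG_of {S T C : H →ₗ.[ℍᵐᵒᵖ] H}
    (h : ∀ x z, (x, z) ∈ C.graph ↔ ∃ y, (x, y) ∈ T.graph ∧ (y, z) ∈ S.graph) : IsCompP S T C := by
  constructor
  · intro x
    constructor
    · intro hx
      obtain ⟨y, h1, h2⟩ := (h _ _).1 (C.mem_graph ⟨x, hx⟩)
      have hd := LinearPMap.mem_domain_of_mem_graph h1
      refine ⟨hd, ?_⟩
      have := LinearPMap.mem_graph_snd_inj T h1 (T.mem_graph ⟨x, hd⟩) rfl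
      rw [← this]
      exact LinearPMap.mem_domain_of_mem_graph h2
    · rintro ⟨h1, h2⟩
      exact LinearPMap.mem_domain_of_mem_graph
        ((h x _).2 ⟨_, T.mem_graph ⟨x, h1⟩, S.mem_graph ⟨_, h2⟩⟩)
  · intro x hx h2
    have := (h x _).2 ⟨_, T.mem_graph ⟨x, hx⟩, S.mem_graph ⟨_, h2⟩⟩
    exact LinearPMap.mem_graph_snd_inj C (C.mem_graph x) this rfl

theorem graph_fun (T : H →ₗ.[ℍᵐᵒᵖ] H) {x y z : H} (h1 : (x, y) ∈ T.graph) (h2 : (x, z) ∈ T.graph) :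
    y = z := LinearPMap.mem_graph_snd_inj T h1 h2 rfl

theorem sep_of_dense {inn : H → H → ℍ} (h : QInner inn) {D : Set H} (hD : Dense D) {z : H}
    (hz : ∀ y ∈ D, inn z y = 0) : z = 0 := by
  by_contra hne
  have hpos : 0 < ‖z‖ := norm_pos_iff.2 hne
  obtain ⟨y, hy, hyz⟩ := Metric.dense_iff.1 hD z ‖z‖ hpos
  rw [Metric.mem_ball, dist_comm, dist_eq_norm] at hy
  have h1 : inn y z = 0 := by rw [h.conj_symm, hz y hyz, star_zero]
  have h2 : ‖z - y‖ ^ 2 = ‖z‖ ^ 2 + ‖y‖ ^ 2 := by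
    rw [← h.re_self, ← h.re_self, ← h.re_self, h.sub_right, h.sub_left, h.sub_left, hz y hyz, h1]
    simp
  have h3 : ‖z - y‖ ^ 2 < ‖z‖ ^ 2 := by gcongr
  nlinarith [sq_nonneg ‖y‖]

/-- The core algebraic statement: a symmetric positive `M` with `1 + M` onto has a unique
positive self-adjoint square root. -/
theorem sqrt_core [CompleteSpace H] {inn : H → H → ℍ} (h : QInner inn) (M : H →ₗ.[ℍᵐᵒᵖ] H)
    (hsym : ∀ x z y v, (x, z) ∈ M.graph → (y, v) ∈ M.graph → inn x v = inn z y)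
    (hpos : ∀ x z, (x, z) ∈ M.graph → 0 ≤ (inn x z).re)
    (hsurj : ∀ w, ∃ y, (y, w - y) ∈ M.graph) :
    ∃ C : H →ₗ.[ℍᵐᵒᵖ] H,
      (IsPosP inn C ∧ IsCompP C C M) ∧
      ∀ C' : H →ₗ.[ℍᵐᵒᵖ] H, IsPosP inn C' ∧ IsCompP C' C' M → C' = C := by
  have huniq : ∀ w y y', (y, w - y) ∈ M.graph → (y', w - y') ∈ M.graph → y = y' := by
    intro w y y' h1 h2
    have h3 := M.graph.sub_mem h1 h2
    have h4 := hpos (y - y') (- (y - y')) (by convert h3 using 1; ext <;> simp)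
    rw [h.neg_right, Quaternion.re_neg, h.re_self] at h4
    have : ‖y - y'‖ = 0 := by
      have := norm_nonneg (y - y')
      nlinarith
    exact sub_eq_zero.1 (norm_eq_zero.1 this)
  choose r hr using hsurj
  let R : H →ₗ[ℍᵐᵒᵖ] H :=
    { toFun := r
      map_add' := fun x y => huniq (x + y) _ _ (hr _) (by
        convert M.graph.add_mem (hr x) (hr y) using 1; ext <;> simp; abel)
      map_smul' := fun q x => huniq (q • x) _ _ (hr _) (by
        convert M.graph.smul_mem q (hr x) using 1; ext <;> simp [smul_sub]) }
  have hR : ∀ w, (R w, w - R w) ∈ M.graph := hr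
  have hRs : ∀ x y, inn (R x) y = inn x (R y) := by
    intro x y
    have := hsym _ _ _ _ (hR x) (hR y)
    rw [h.sub_right, h.sub_left] at this
    simpa using this
  have hRnn : ∀ x, 0 ≤ (inn (R x) (x - R x)).re := fun x => hpos _ _ (hR x)
  obtain ⟨A, B, hA, hB, hAA, hBB, hAB, hABp, hG⟩ := q_sqrt h R hRs
    (fun x => by
      have h1 := hRnn x
      rw [h.sub_right, hRs, Quaternion.re_sub, h.re_self] at h1
      nlinarith [sq_nonneg ‖R x‖])
    (fun x => by
      have h1 := hRnn x
      have h2 := h.re_self (x - R x)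
      rw [h.sub_right, hRs, Quaternion.re_sub] at h1
      rw [h.sub_right, h.sub_left, h.sub_left, hRs] at h2
      simp only [Quaternion.re_sub] at h2
      nlinarith [sq_nonneg ‖x - R x‖])
  have hRinj : ∀ u, R u = 0 → u = 0 := fun u hu => by
    have := hR u
    rw [hu, sub_zero] at this
    exact LinearPMap.graph_fst_eq_zero_snd M this rfl
  have hAinj : ∀ u, A u = 0 → u = 0 := fun u hu => hRinj u (by rw [← hAA, hu, map_zero])
  have hsum : ∀ u, A (A u) + B (B u) = u := fun u => by rw [hAA, hBB]; abel
  -- the square root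
  let gr : Submodule ℍᵐᵒᵖ (H × H) := LinearMap.range (A.prod B)
  let C := gr.toLinearPMap
  have hCg : ∀ x z, (x, z) ∈ C.graph ↔ ∃ u, A u = x ∧ B u = z := by
    intro x z
    have : C.graph = gr := Submodule.toLinearPMap_graph_eq gr (by
      rintro ⟨x, z⟩ ⟨u, hu⟩ hx
      have hu : A u = x ∧ B u = z := Prod.mk.inj hu
      simp only at hx ⊢
      rw [← hu.2, hAinj u (hu.1.trans hx), map_zero])
    rw [this]
    simp [gr, LinearMap.mem_range]
  refine ⟨C, ⟨⟨adjG_of ?_ ?_, ?_⟩, compG_of ?_⟩, ?_⟩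
  · intro x x' y y' hx hy
    obtain ⟨u, rfl, rfl⟩ := (hCg _ _).1 hx
    obtain ⟨v, rfl, rfl⟩ := (hCg _ _).1 hy
    rw [hA, hB, hAB]
  · intro x z hxz
    have h1 : B x = A z := h.ext_left fun u => by
      rw [hB, hA]; exact hxz _ _ ((hCg _ _).2 ⟨u, rfl, rfl⟩)
    refine ⟨_, (hCg _ _).2 ⟨A x + B z, ?_, rfl⟩⟩
    rw [map_add, hAB, ← h1, hsum]
  · intro x
    obtain ⟨u, hu1, hu2⟩ := (hCg _ _).1 (C.mem_graph x)
    rw [← hu1, ← hu2]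
    have h1 : inn (A u) (B u) = inn u (A (B u)) := hA _ _
    have h2 : inn u (A (B u)) = inn (A (B u)) u := by rw [hA, hB, hAB]
    refine ⟨_, hABp u, ?_⟩
    rw [h1]
    exact h.real_of h2
  · intro x z
    constructor
    · intro hx
      have h1 : R (x + z) = x := huniq (x + z) _ _ (hR _) (by simpa using hx)
      refine ⟨_, (hCg _ _).2 ⟨A (x + z), by rw [hAA, h1], rfl⟩,
        (hCg _ _).2 ⟨B (x + z), hAB _, ?_⟩⟩
      rw [hBB, h1]; abel
    · rintro ⟨y, h1, h2⟩
      obtain ⟨u, rfl, rfl⟩ := (hCg _ _).1 h1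
      obtain ⟨v, hv, rfl⟩ := (hCg _ _).1 h2
      set w := A u + B v with hw
      have hu : u = A w := by rw [hw, map_add, hAB, hv, hsum]
      have hv' : v = B w := by rw [hw, map_add, ← hAB, ← hv, hsum]
      rw [hu, hv', hAA, hBB]
      exact hR w
  · rintro C' ⟨⟨hC'a, hC'p⟩, hC'c⟩
    have hp' : ∀ x z, (x, z) ∈ C'.graph → 0 ≤ (inn x z).re := by
      intro x z hx
      rw [LinearPMap.mem_graph_iff] at hx
      obtain ⟨a, rfl, rfl⟩ := hx
      obtain ⟨s, hs, he⟩ := hC'p a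
      rw [he, Quaternion.re_coe]; exact hs
    choose g hg1 hg2 using fun w => (compG hC'c).1 (hR w)
    let G : H →ₗ[ℍᵐᵒᵖ] H :=
      { toFun := g
        map_add' := fun x y => graph_fun C' (hg1 _) (by
          rw [map_add]; exact C'.graph.add_mem (hg1 x) (hg1 y))
        map_smul' := fun q x => graph_fun C' (hg1 _) (by
          rw [map_smul]; exact C'.graph.smul_mem q (hg1 x)) }
    have hG1 : ∀ w, (R w, G w) ∈ C'.graph := hg1
    have hG2 : ∀ w, (G w, w - R w) ∈ C'.graph := hg2
    have hGs : ∀ x y, inn (G x) y = inn x (G y) := by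
      intro x y
      have h1 := adjG1 hC'a (hG2 x) (hG2 y)
      have h2 := adjG1 hC'a (hG1 x) (hG1 y)
      rw [h.sub_right, h.sub_left, h2] at h1
      have h3 : inn (G x) (R y) = inn (R x) (G y) := h2.symm
      rw [h3] at h1
      exact sub_left_injective h1
    have hGp : ∀ x, 0 ≤ (inn x (G x)).re := by
      intro x
      have h1 := hp' _ _ (hG1 x)
      have h2 := hp' _ _ (hG2 x)
      rw [h.sub_right, Quaternion.re_sub, hGs, h.re_symm (G x) (R x)] at h2
      linarith
    have hGG : ∀ x, G (G x) = R x - R (R x) := by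
      intro x
      refine h.ext_left fun y => ?_
      rw [hGs, adjG1 hC'a (hG2 x) (hG1 y), ← hRs, map_sub]
    have hGAB := hG G hGs hGp hGG
    have hsub : ∀ x z, (x, z) ∈ C'.graph → (x, z) ∈ C.graph := by
      intro x z hx
      have h1 : R z = B (A x) := h.ext_left fun w => by
        rw [hRs, hB, hA, ← hGAB]
        exact (adjG1 hC'a hx (hG1 w)).symm
      have h2 : A z = B x := by
        rw [← hAA, ← hAB] at h1
        have := hAinj (A z - B x) (by rw [map_sub, h1, sub_self])
        exact sub_eq_zero.1 this
      rw [hCg]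
      refine ⟨A x + B z, ?_, ?_⟩
      · rw [map_add, hAB, h2, hsum]
      · rw [map_add, ← hAB, ← h2, hsum]
    apply LinearPMap.eq_of_eq_graph
    ext ⟨x, z⟩
    refine ⟨hsub x z, fun hx => ?_⟩
    obtain ⟨z', hz'⟩ := adjG2 hC'a (x := x) (z := z) (fun y y' hy => by
      obtain ⟨u, rfl, rfl⟩ := (hCg _ _).1 hx
      obtain ⟨v, rfl, rfl⟩ := (hCg _ _).1 (hsub _ _ hy)
      rw [hA, hB, hAB])
    rwa [graph_fun C hx (hsub _ _ hz')]

end Graphs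

/-- for a densely defined closed operator `T` with adjoint `Ts = T*` and
`TsT = T*T`, the operator `T*T` is positive, and hence admits a unique positive
square root `|T|`. -/
theorem adjoint_comp_positive_and_sqrt
    [CompleteSpace H] (inn : H → H → ℍ) (hinn : QInner inn)
    (T Ts TsT : H →ₗ.[ℍᵐᵒᵖ] H)
    (hdense : Dense (T.domain : Set H))
    (hclosed : IsClosed (T.graph : Set (H × H)))
    (hadj : IsAdjP inn T Ts) (hcomp : IsCompP Ts T TsT) :
    (∀ x : TsT.domain, ∃ r : ℝ, 0 ≤ r ∧ inn (x : H) (TsT x) = (r : ℍ)) ∧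
    ∃ C : H →ₗ.[ℍᵐᵒᵖ] H,
      (IsPosP inn C ∧ IsCompP C C TsT) ∧
      ∀ C' : H →ₗ.[ℍᵐᵒᵖ] H, IsPosP inn C' ∧ IsCompP C' C' TsT → C' = C := by
  have hM : ∀ x z, (x, z) ∈ TsT.graph → ∃ y, (x, y) ∈ T.graph ∧ (y, z) ∈ Ts.graph :=
    fun x z hx => (compG hcomp).1 hx
  have hval : ∀ x z, (x, z) ∈ TsT.graph → ∃ r : ℝ, 0 ≤ r ∧ inn x z = (r : ℍ) := by
    intro x z hx
    obtain ⟨y, h1, h2⟩ := hM x z hx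
    refine ⟨‖y‖ ^ 2, by positivity, ?_⟩
    rw [hinn.conj_symm, ← adjG1 hadj h2 h1, ← hinn.conj_symm, hinn.norm_sq]
  refine ⟨fun x => hval _ _ (TsT.mem_graph x), sqrt_core hinn TsT ?_ ?_ ?_⟩
  · intro x z y v hx hy
    obtain ⟨a, h1, h2⟩ := hM x z hx
    obtain ⟨b, h3, h4⟩ := hM y v hy
    rw [← adjG1 hadj h2 h3, hinn.conj_symm, ← adjG1 hadj h4 h1, ← hinn.conj_symm]
  · intro x z hx
    obtain ⟨r, hr, he⟩ := hval x z hx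
    rw [he, Quaternion.re_coe]; exact hr
  · intro w
    obtain ⟨⟨y, t⟩, hp, hq⟩ := q_proj hinn T.graph hclosed w
    have hq' : ∀ z z', (z, z') ∈ T.graph → inn t z' = inn (w - y) z :=
      fun z z' hz => (hq _ hz).symm
    obtain ⟨s, hs⟩ := adjG2 hadj hq'
    refine ⟨y, (compG hcomp).2 ⟨t, hp, ?_⟩⟩
    have : s - (w - y) = 0 := sep_of_dense hinn hdense fun z hz => by
      have hz' := T.mem_graph ⟨z, hz⟩
      rw [hinn.sub_left, ← adjG1 hadj hs hz', hq' _ _ hz', sub_self]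
    rwa [← sub_eq_zero.1 this]
end
end

section
/- If T is a densely defined closed self-adjoint (resp. anti self-adjoint) operator in a quaternionic Hilbert space with polar decomposition T = U₀|T|, N(U₀) = N(T), then U₀ is self-adjoint (resp. anti self-adjoint). -/
noncomputable section

open MulOpposite

local notation "ℍ" => Quaternion ℝ

variable {H : Type*} [NormedAddCommGroup H] [Module ℍᵐᵒᵖ H]

open ContinuousLinearMap in
theorem aux_bdd {E : Type*} [NormedAddCommGroup E] [InnerProductSpace ℂ E] [CompleteSpace E]
    (U p : E →L[ℂ] E) (ε : ℂ) (hε : ε = 1 ∨ ε = -1) (hp : 0 ≤ p)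
    (ht : star (U * p) = ε • (U * p)) (hk : ∀ x, p x = 0 ↔ U x = 0)
    (hiso : ∀ x, (∀ y, U y = 0 → inner ℂ y x = 0) → ‖U x‖ = ‖x‖) :
    star U = ε • U := by
  have hps : star p = p := (IsSelfAdjoint.of_nonneg hp).star_eq
  have hεε : ε * ε = 1 := by rcases hε with h | h <;> simp [h]
  have hεs : star ε = ε := by rcases hε with h | h <;> simp [h]
  have hadj : ∀ (A : E →L[ℂ] E) x y, inner ℂ (star A x) y = inner ℂ x (A y) := fun A x y => by
    rw [star_eq_adjoint, adjoint_inner_left]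
  have hadj' : ∀ (A : E →L[ℂ] E) x y, inner ℂ x (star A y) = inner ℂ (A x) y := fun A x y => by
    rw [star_eq_adjoint, adjoint_inner_right]
  set K := LinearMap.ker (U : E →ₗ[ℂ] E) with hK
  have hKm : ∀ x, x ∈ K ↔ U x = 0 := fun x => by simp [hK]
  have hKc : IsClosed (K : Set E) := U.isClosed_ker
  have : CompleteSpace K := hKc.completeSpace_coe
  let V : Kᗮ →ₗᵢ[ℂ] E := ⟨(U : E →ₗ[ℂ] E).comp Kᗮ.subtype, fun x => hiso x fun y hy =>
    (Submodule.mem_orthogonal _ _).1 x.2 y ((hKm y).2 hy)⟩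
  have hV : ∀ u ∈ Kᗮ, ∀ v ∈ Kᗮ, inner ℂ (U u) (U v) = inner ℂ u v := fun u hu v hv =>
    V.inner_map_map ⟨u, hu⟩ ⟨v, hv⟩
  have hUU : ∀ u ∈ Kᗮ, (star U) (U u) = u := by
    intro u hu
    refine ext_inner_right ℂ fun v => ?_
    obtain ⟨a, ha, b, hb, rfl⟩ := K.exists_add_mem_mem_orthogonal v
    rw [hadj, map_add, (hKm a).1 ha, zero_add, hV u hu b hb, inner_add_right,
      (Submodule.mem_orthogonal' _ _).1 hu a ha, zero_add]
  have hran : ∀ x, p x ∈ Kᗮ := fun x => (Submodule.mem_orthogonal _ _).2 fun u hu => by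
    rw [← hps, hadj', (hk u).2 ((hKm u).1 hu), inner_zero_left]
  have htp : U * p = ε • (p * star U) := by
    have : p * star U = ε • (U * p) := by rw [← ht, star_mul, hps]
    rw [this, smul_smul, hεε, one_smul]
  have htr : ∀ x, (U * p) x ∈ Kᗮ := fun x => by
    rw [htp]; exact Submodule.smul_mem _ _ (hran _)
  have h1 : star U * (U * p) = p := by ext x; exact hUU _ (hran x)
  have h2 : star U * (U * (U * p)) = U * p := by ext x; exact hUU _ (htr x)
  have hc : 0 ≤ U * p * star U := by
    have := star_left_conjugate_nonneg hp (star U)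
    simpa using this
  have htt : p * star U = ε • (U * p) := by rw [← ht, star_mul, hps]
  have hsq : (U * p * star U) * (U * p * star U) = p * p := by
    calc (U * p * star U) * (U * p * star U) = U * p * (star U * (U * (p * star U))) := by
          simp only [mul_assoc]
      _ = (U * p) * (p * star U) := by
          rw [htt, mul_smul_comm, mul_smul_comm, h2]
      _ = (ε • (p * star U)) * (ε • (U * p)) := by rw [← htt, ← htp]
      _ = p * (star U * (U * p)) := by
          rw [smul_mul_smul_comm, hεε, one_smul, mul_assoc]
      _ = p * p := by rw [h1]
  have hcp : U * p * star U = p := by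
    rw [← CFC.sqrt_mul_self (U * p * star U) hc, hsq, CFC.sqrt_mul_self p hp]
  have h3 : p = ε • (U * (U * p)) := by
    conv_lhs => rw [← hcp, mul_assoc, htt, mul_smul_comm]
  have h4 : star U * p = ε • (U * p) := by
    conv_lhs => rw [h3, mul_smul_comm, h2]
  set W := star U - ε • U with hW
  have hWp : W * p = 0 := by rw [hW, sub_mul, h4, smul_mul_assoc, sub_self]
  have hpW : p * star W = 0 := by
    have := congrArg star hWp
    rwa [star_mul, hps, star_zero] at this
  have hn : ∀ n, p n = 0 → W n = 0 := by
    intro n hn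
    have h5 : p (star U n) = 0 := by
      have := congrArg (fun A : E →L[ℂ] E => A n) htt
      simpa [hn] using this
    have h6 : star U n = 0 := by
      rw [← inner_self_eq_zero (𝕜 := ℂ), hadj, (hk _).1 h5, inner_zero_right]
    simp [hW, h6, (hk n).1 hn]
  have hWW : W * star W = 0 := by
    ext x
    exact hn _ (congrArg (fun A : E →L[ℂ] E => A x) hpW)
  have : W = 0 := by
    simpa using (CStarRing.mul_star_self_eq_zero_iff W).1 hWW
  exact sub_eq_zero.1 this

open scoped ComplexOrder in
theorem aux_unbdd {E : Type*} [NormedAddCommGroup E] [InnerProductSpace ℂ E] [CompleteSpace E]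
    (D : Submodule ℂ E) (T P : D →ₗ[ℂ] E) (U : E →L[ℂ] E) (ε : ℂ) (hε : ε = 1 ∨ ε = -1)
    (hd : Dense (D : Set E)) (hcl : IsClosed {w : E × E | ∃ x : D, (x : E) = w.1 ∧ T x = w.2})
    (hTP : ∀ x, T x = U (P x))
    (hTs : ∀ x y : D, inner ℂ (x : E) (T y) = ε * inner ℂ (T x) (y : E))
    (hmax : ∀ x z : E, (∀ y : D, inner ℂ x (T y) = inner ℂ z (y : E)) → x ∈ D)
    (hPs : ∀ x y : D, inner ℂ (x : E) (P y) = inner ℂ (P x) (y : E))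
    (hPp : ∀ x : D, 0 ≤ inner ℂ (x : E) (P x))
    (hdom : ∀ x : D, T x ∈ D ↔ P x ∈ D)
    (hsq : ∀ (x : D) (h : T x ∈ D) (h' : P x ∈ D), T ⟨T x, h⟩ = ε • P ⟨P x, h'⟩)
    (hiso : ∀ x, (∀ y, U y = 0 → inner ℂ y x = 0) → ‖U x‖ = ‖x‖)
    (hker : ∀ x : E, U x = 0 ↔ ∃ h : x ∈ D, T ⟨x, h⟩ = 0) (x y : E) :
    inner ℂ (U x) y = ε * inner ℂ x (U y) := by
  have hεε : ε * ε = 1 := by rcases hε with h | h <;> simp [h]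
  have hεs : starRingEnd ℂ ε = ε := by rcases hε with h | h <;> simp [h]
  have hkTP : ∀ x : D, T x = 0 → P x = 0 := by
    intro x hx
    have h1 : T x ∈ D := by rw [hx]; exact D.zero_mem
    have h2 := (hdom x).1 h1
    have h3 := hsq x h1 h2
    have h4 : T ⟨T x, h1⟩ = 0 := by
      have : (⟨T x, h1⟩ : D) = 0 := Subtype.ext hx
      rw [this, map_zero]
    rw [h4] at h3
    have h5 : P ⟨P x, h2⟩ = 0 := by
      have := congrArg (fun v => ε • v) h3
      simpa [smul_smul, hεε] using this.symm
    have h6 := hPs x ⟨P x, h2⟩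
    rw [h5, inner_zero_right] at h6
    exact inner_self_eq_zero.1 h6.symm
  -- resolvent
  have hres : ∀ x : E, ∃ (y : D) (h : P y ∈ D), (y : E) + P ⟨P y, h⟩ = x := by
    intro x
    let G : Submodule ℂ (WithLp 2 (E × E)) :=
      { carrier := {w | ∃ x : D, (x : E) = w.fst ∧ T x = w.snd}
        zero_mem' := ⟨0, by simp⟩
        add_mem' := by
          rintro a b ⟨x, hx, hx'⟩ ⟨y, hy, hy'⟩
          exact ⟨x + y, by simp [hx, hy], by simp [hx', hy']⟩
        smul_mem' := by
          rintro c a ⟨x, hx, hx'⟩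
          exact ⟨c • x, by simp [hx], by simp [hx']⟩ }
    have hGc : IsClosed (G : Set (WithLp 2 (E × E))) :=
      hcl.preimage (WithLp.prod_continuous_ofLp 2 E E)
    have : CompleteSpace G := hGc.completeSpace_coe
    obtain ⟨g, ⟨y, hy1, hy2⟩, z, hz, hgz⟩ :=
      G.exists_add_mem_mem_orthogonal (WithLp.toLp 2 (x, (0 : E)))
    have e1 : z.fst = x - y := by
      have := congrArg (fun w : WithLp 2 (E × E) => w.fst) hgz
      simp only [WithLp.add_fst, ← hy1] at this
      rw [eq_sub_iff_add_eq, add_comm]; exact this.symm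
    have e2 : z.snd = - T y := by
      have := congrArg (fun w : WithLp 2 (E × E) => w.snd) hgz
      simp only [WithLp.add_snd, ← hy2] at this
      rw [eq_neg_iff_add_eq_zero, add_comm]; exact this.symm
    have key : ∀ v : D, inner ℂ (T y) (T v) = inner ℂ (x - y) (v : E) := by
      intro v
      have := (Submodule.mem_orthogonal' _ _).1 hz (WithLp.toLp 2 ((v : E), T v)) ⟨v, rfl, rfl⟩
      rw [WithLp.prod_inner_apply] at this
      change inner ℂ z.fst (v : E) + inner ℂ z.snd (T v) = 0 at this
      rw [e1, e2, inner_neg_left] at this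
      linear_combination -this
    have hTy : T y ∈ D := hmax _ _ key
    have hPy := (hdom y).1 hTy
    refine ⟨y, hPy, ?_⟩
    have h7 : P ⟨P y, hPy⟩ = x - y := by
      refine hd.eq_of_inner_left ℂ fun v hv => ?_
      have h8 := hTs ⟨T y, hTy⟩ ⟨v, hv⟩
      rw [hsq y hTy hPy, inner_smul_left, hεs, ← mul_assoc, hεε, one_mul] at h8
      have h9 := key ⟨v, hv⟩
      rw [← h9]; exact h8.symm
    rw [h7]; abel
  choose r hr hrx using hres
  have huniq : ∀ (y : D) (h : P y ∈ D), (y : E) + P ⟨P y, h⟩ = 0 → y = 0 := by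
    intro y h h0
    have h1 := hPs y ⟨P y, h⟩
    have h2 : inner ℂ (y : E) ((y : E) + P ⟨P y, h⟩) = 0 := by rw [h0, inner_zero_right]
    rw [inner_add_right, h1, inner_self_eq_norm_sq_to_K, inner_self_eq_norm_sq_to_K] at h2
    have h3 : ‖(y : E)‖ ^ 2 + ‖P y‖ ^ 2 = 0 :=
      Complex.ofReal_eq_zero.1 (by push_cast; exact h2)
    have : ‖(y : E)‖ = 0 := by nlinarith [sq_nonneg ‖(y : E)‖, sq_nonneg ‖P y‖]
    exact Subtype.ext (norm_eq_zero.1 this)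
  have huniq' : ∀ (y : D) (h : P y ∈ D) (x : E), (y : E) + P ⟨P y, h⟩ = x → r x = y := by
    intro y h x hx
    refine sub_eq_zero.1 (huniq (r x - y) (by rw [map_sub]; exact D.sub_mem (hr x) h) ?_)
    have : (⟨P (r x - y), by rw [map_sub]; exact D.sub_mem (hr x) h⟩ : D)
        = ⟨P (r x), hr x⟩ - ⟨P y, h⟩ := Subtype.ext (map_sub _ _ _)
    rw [this, map_sub]
    have h1 := hrx x
    rw [← hx] at h1
    rw [Submodule.coe_sub, sub_add_sub_comm, hx, hrx, sub_self]
  let R : E →ₗ[ℂ] D :=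
    { toFun := r
      map_add' := fun a b => by
        refine huniq' _ (by rw [map_add]; exact D.add_mem (hr a) (hr b)) _ ?_
        have : (⟨P (r a + r b), by rw [map_add]; exact D.add_mem (hr a) (hr b)⟩ : D)
          = ⟨P (r a), hr a⟩ + ⟨P (r b), hr b⟩ := Subtype.ext (map_add _ _ _)
        rw [this, map_add, Submodule.coe_add, add_add_add_comm, hrx, hrx]
      map_smul' := fun c a => by
        refine huniq' _ (by rw [map_smul]; exact D.smul_mem c (hr a)) _ ?_
        have : (⟨P (c • r a), by rw [map_smul]; exact D.smul_mem c (hr a)⟩ : D)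
          = c • ⟨P (r a), hr a⟩ := Subtype.ext (map_smul _ _ _)
        simp only [RingHom.id_apply]
        rw [this, map_smul, Submodule.coe_smul, ← smul_add, hrx] }
  let p₀ : E →ₗ[ℂ] E := P.comp R
  have hp₀ : ∀ x, p₀ x = P (r x) := fun x => rfl
  have hsym : p₀.IsSymmetric := by
    intro a b
    rw [hp₀, hp₀]
    conv_lhs => rw [← hrx b]
    conv_rhs => rw [← hrx a]
    rw [inner_add_left, inner_add_right, hPs]
    congr 1
    exact hPs ⟨P (r a), hr a⟩ ⟨P (r b), hr b⟩
  let p : E →L[ℂ] E := ⟨p₀, hsym.continuous⟩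
  have hpx : ∀ x, p x = P (r x) := fun x => rfl
  have hpp : 0 ≤ p := by
    rw [ContinuousLinearMap.nonneg_iff_isPositive, ContinuousLinearMap.isPositive_iff]
    refine ⟨hsym, fun a => ?_⟩
    rw [hpx]
    have e : inner ℂ (P (r a)) a = inner ℂ (P (r a)) ((r a : E) + P ⟨P (r a), hr a⟩) := by
      rw [hrx a]
    rw [e, inner_add_right, ← hPs]
    exact add_nonneg (hPp _) (hPp ⟨P (r a), hr a⟩)
  have hUp : ∀ x, (U * p) x = T (r x) := fun x => by rw [hTP]; rfl
  have htadj : star (U * p) = ε • (U * p) := by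
    rw [ContinuousLinearMap.star_eq_adjoint]
    refine ((ContinuousLinearMap.eq_adjoint_iff _ _).2 fun a b => ?_).symm
    rw [_root_.smul_apply, hUp, hUp, inner_smul_left, hεs]
    conv_lhs => rw [← hrx b]
    conv_rhs => rw [← hrx a]
    have ha := (hdom (r a)).2 (hr a)
    have hb := (hdom (r b)).2 (hr b)
    have qa := hsq (r a) ha (hr a)
    have qb := hsq (r b) hb (hr b)
    have h1 := hTs ⟨T (r a), ha⟩ (r b)
    have h2 := hTs (r a) (r b)
    have h3 := hTs ⟨T (r a), ha⟩ ⟨T (r b), hb⟩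
    rw [qa, qb, inner_smul_left, inner_smul_right, hεs] at h3
    simp only at h3
    rw [inner_add_left, inner_add_right, h2]
    linear_combination h3 + (inner ℂ (P ⟨P (r a), hr a⟩) (T (r b))) * hεε
  have hk : ∀ x, p x = 0 ↔ U x = 0 := by
    intro x
    rw [hker, hpx]
    constructor
    · intro h
      have h1 : (⟨P (r x), hr x⟩ : D) = 0 := Subtype.ext h
      have h2 := hrx x
      rw [h1, map_zero, add_zero] at h2
      have h3 : x ∈ D := h2 ▸ (r x).2
      refine ⟨h3, ?_⟩
      have h4 : (⟨x, h3⟩ : D) = r x := Subtype.ext h2.symm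
      rw [h4, hTP, h, map_zero]
    · rintro ⟨h, h0⟩
      have h1 := hkTP _ h0
      have h2 : P ⟨x, h⟩ ∈ D := by rw [h1]; exact D.zero_mem
      have h3 : (⟨P ⟨x, h⟩, h2⟩ : D) = 0 := Subtype.ext h1
      rw [huniq' ⟨x, h⟩ h2 x (by rw [h3, map_zero, add_zero]), h1]
  have hfin := aux_bdd U p ε hε hpp htadj hk hiso
  have h := ContinuousLinearMap.adjoint_inner_right U x y
  rw [← ContinuousLinearMap.star_eq_adjoint, hfin, _root_.smul_apply,
    inner_smul_right] at h
  exact h.symm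

/-- The ring homomorphism `ℂ → ℍᵐᵒᵖ`. -/
def aux_hom : ℂ →+* ℍᵐᵒᵖ where
  toFun z := op (Quaternion.coeComplex z)
  map_one' := by simp
  map_zero' := by simp
  map_add' a b := by simp
  map_mul' a b := by rw [mul_comm]; simp

/-- Complex part of a quaternion. -/
def aux_cpart (q : ℍ) : ℂ := ⟨q.re, q.imI⟩

theorem aux_norm_smul (inn : H → H → ℍ) (hinn : QInner inn) (q : ℍ) (x : H) :
    ‖op q • x‖ = ‖q‖ * ‖x‖ := by
  have h1 := hinn.norm_sq (op q • x)
  rw [hinn.smul_right, hinn.conj_symm, hinn.smul_right, hinn.norm_sq, star_mul,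
    Quaternion.star_coe, ← Quaternion.coe_commutes, mul_assoc, Quaternion.star_mul_self,
    Quaternion.normSq_eq_norm_mul_self, ← Quaternion.coe_mul] at h1
  have h3 : ‖op q • x‖ ^ 2 = (‖q‖ * ‖x‖) ^ 2 := by
    rw [← Quaternion.coe_injective h1]; ring
  exact (sq_eq_sq₀ (norm_nonneg _) (by positivity)).1 h3

/-- The complex inner product space underlying a quaternionic one. -/
@[reducible] def aux_ips (inn : H → H → ℍ) (hinn : QInner inn) : InnerProductSpace ℂ H :=
  { Module.compHom H aux_hom with
    norm_smul_le := fun z x => by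
      change ‖op (Quaternion.coeComplex z) • x‖ ≤ _
      rw [aux_norm_smul inn hinn]
      have : ‖Quaternion.coeComplex z‖ = ‖z‖ := by
        have h : ‖Quaternion.coeComplex z‖ ^ 2 = ‖z‖ ^ 2 := by
          rw [sq, ← Quaternion.normSq_eq_norm_mul_self, Quaternion.normSq_def', Complex.sq_norm,
            Complex.normSq_apply]
          simp; ring
        exact (sq_eq_sq₀ (norm_nonneg _) (norm_nonneg _)).1 h
      rw [this]
    inner := fun x y => aux_cpart (inn x y)
    norm_sq_eq_re_inner := fun x => by
      change _ = (inn x x).re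
      rw [hinn.norm_sq]; exact (Quaternion.re_coe _).symm
    conj_inner_symm := fun x y => by
      rw [hinn.conj_symm x y]
      apply Complex.ext <;> simp [aux_cpart]
    add_left := fun x y z => by
      rw [hinn.conj_symm, hinn.add_right, hinn.conj_symm x, hinn.conj_symm y]
      apply Complex.ext
      · simp [aux_cpart]
      · simp [aux_cpart]
    smul_left := fun x y z => by
      change aux_cpart (inn (op (Quaternion.coeComplex z) • x) y) = _
      rw [hinn.conj_symm, hinn.smul_right, hinn.conj_symm x]
      apply Complex.ext <;> simp [aux_cpart] <;> ring }

theorem aux_full (inn : H → H → ℍ) (hinn : QInner inn) (a x b z : H)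
    (h : ∀ q : ℍ, aux_cpart (inn a (op q • x)) = aux_cpart (inn b (op q • z))) :
    inn a x = inn b z := by
  obtain ⟨j, j0, j1, j2, j3⟩ : ∃ j : ℍ, j.re = 0 ∧ j.imI = 0 ∧ j.imJ = 1 ∧ j.imK = 0 :=
    ⟨⟨0, 0, 1, 0⟩, rfl, rfl, rfl, rfl⟩
  have h1 := h 1
  have h2 := h j
  rw [hinn.smul_right, hinn.smul_right] at h1 h2
  simp only [mul_one] at h1
  have a1 := congrArg Complex.re h1
  have a2 := congrArg Complex.im h1
  have a3 := congrArg Complex.re h2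
  have a4 := congrArg Complex.im h2
  simp only [aux_cpart, Quaternion.re_mul, Quaternion.imI_mul, j0, j1, j2, j3] at a1 a2 a3 a4
  ext <;> linarith

theorem aux_sub (inn : H → H → ℍ) (ε : ℝ) (x y u v : H)
    (h : inn x y = (ε : ℍ) * inn u v) : aux_cpart (inn x y) = (ε : ℂ) * aux_cpart (inn u v) := by
  rw [h]
  apply Complex.ext <;> simp [aux_cpart]

open scoped ComplexOrder in
theorem aux_main
    [CompleteSpace H] (inn : H → H → ℍ) (hinn : QInner inn)
    (T P : H →ₗ.[ℍᵐᵒᵖ] H) (U₀ : H →L[ℍᵐᵒᵖ] H) (ε : ℝ) (hε : ε = 1 ∨ ε = -1)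
    (hdense : Dense (T.domain : Set H))
    (hclosed : IsClosed (T.graph : Set (H × H)))
    (hTs : ∀ x y : T.domain, inn (x : H) (T y) = (ε : ℍ) * inn (T x) (y : H))
    (hmax : ∀ x z : H, (∀ y : T.domain, inn x (T y) = inn z (y : H)) → x ∈ T.domain)
    (hP : IsPosP inn P)
    (hdom : ∀ (x : T.domain) (x' : P.domain), (x : H) = x' → (T x ∈ T.domain ↔ P x' ∈ P.domain))
    (hsq : ∀ (x : T.domain) (x' : P.domain), (x : H) = x' →
      ∀ (h : T x ∈ T.domain) (h' : P x' ∈ P.domain), T ⟨T x, h⟩ = op (ε : ℍ) • P ⟨P x', h'⟩)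
    (hU : IsPartialIsomB inn U₀) (hker : kerB U₀ = pKer T)
    (hfact : EqCompB T U₀ P) (x y : H) : inn (U₀ x) y = (ε : ℍ) * inn x (U₀ y) := by
  let _ := aux_ips inn hinn
  have hsm : ∀ (c : ℂ) (x : H), c • x = op (Quaternion.coeComplex c) • x := fun _ _ => rfl
  have hin : ∀ x y : H, inner ℂ x y = aux_cpart (inn x y) := fun _ _ => rfl
  have hortho : ∀ x y : H, (∀ q : ℍ, inner ℂ x (op q • y) = 0) → inn x y = 0 := by
    intro x y h
    have h1 : inn x 0 = 0 := by
      have := hinn.smul_right x 0 0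
      simpa using this
    rw [← h1]
    refine aux_full inn hinn _ _ _ _ fun q => ?_
    rw [← hin, h, smul_zero, h1]; rfl
  obtain ⟨hDD, hUP⟩ := hfact
  let D : Submodule ℂ H :=
    { carrier := T.domain
      zero_mem' := T.domain.zero_mem
      add_mem' := fun ha hb => T.domain.add_mem ha hb
      smul_mem' := fun c _ ha => T.domain.smul_mem _ ha }
  have hDP : ∀ x : D, (x : H) ∈ P.domain := fun x => hDD ▸ x.2
  let T' : D →ₗ[ℂ] H :=
    { toFun := fun x => T ⟨x, x.2⟩
      map_add' := fun a b => T.map_add ⟨a, a.2⟩ ⟨b, b.2⟩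
      map_smul' := fun c a => T.map_smul (aux_hom c) ⟨a, a.2⟩ }
  let P' : D →ₗ[ℂ] H :=
    { toFun := fun x => P ⟨x, hDP x⟩
      map_add' := fun a b => P.map_add ⟨a, hDP a⟩ ⟨b, hDP b⟩
      map_smul' := fun c a => P.map_smul (aux_hom c) ⟨a, hDP a⟩ }
  let U' : H →L[ℂ] H :=
    { toFun := U₀
      map_add' := fun a b => U₀.map_add a b
      map_smul' := fun c a => U₀.map_smul (aux_hom c) a
      cont := U₀.continuous }
  have hε' : ((ε : ℝ) : ℂ) = 1 ∨ ((ε : ℝ) : ℂ) = -1 := by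
    rcases hε with h | h <;> simp [h]
  have key := aux_unbdd D T' P' U' (ε : ℂ) hε' hdense
    (by
      convert hclosed using 1
      ext w
      simp only [Set.mem_ofPred_eq, SetLike.mem_coe, LinearPMap.mem_graph_iff]
      exact ⟨fun ⟨a, h⟩ => ⟨⟨a, a.2⟩, h⟩, fun ⟨a, h⟩ => ⟨⟨a, a.2⟩, h⟩⟩)
    (fun a => hUP a a.2 (hDP a))
    (fun a b => aux_sub inn ε _ _ _ _ (hTs ⟨a, a.2⟩ ⟨b, b.2⟩))
    (fun a b h => by
      refine hmax a b fun y => aux_full inn hinn _ _ _ _ fun q => ?_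
      have h1 := h ⟨op q • (y : H), T.domain.smul_mem _ y.2⟩
      have h2 : T ⟨op q • (y : H), T.domain.smul_mem _ y.2⟩ = op q • T y := T.map_smul _ y
      rw [← h2]
      exact h1)
    (fun a b => congrArg aux_cpart (hP.1.1 ⟨a, hDP a⟩ ⟨b, hDP b⟩))
    (fun a => by
      obtain ⟨r, hr, h⟩ := hP.2 ⟨a, hDP a⟩
      have h1 : inner ℂ (a : H) (P' a) = (r : ℂ) := by
        refine (congrArg aux_cpart h).trans ?_
        apply Complex.ext <;> simp [aux_cpart]
      rw [h1]
      exact_mod_cast hr)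
    (fun a => by
      have := hdom ⟨a, a.2⟩ ⟨a, hDP a⟩ rfl
      have h2 : ∀ v : H, v ∈ P.domain ↔ v ∈ T.domain := fun v => by rw [hDD]
      exact this.trans (h2 _))
    (fun a h h' => by
      have := hsq ⟨a, a.2⟩ ⟨a, hDP a⟩ rfl h (hDP ⟨_, h'⟩)
      rw [hsm, Quaternion.coeComplex_coe]
      exact this)
    (fun a h => hU a fun b hb => by
      have hb' : U₀ b = 0 := hb
      rw [hinn.conj_symm, hortho a b fun q => ?_, star_zero]
      rw [← inner_conj_symm, h, map_zero]
      change U₀ (op q • b) = 0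
      rw [map_smul, hb', smul_zero])
    (fun a => by
      have := Set.ext_iff.1 hker a
      exact this)
  have hU' : ∀ q : ℍ, inner ℂ (U₀ x) (op q • y) = inner ℂ x (op (ε : ℍ) • op q • U₀ y) := by
    intro q
    have h1 : inner ℂ (U₀ x) (op q • y) = _ := key x (op q • y)
    rw [h1]
    have h2 : U' (op q • y) = op q • U₀ y := U₀.map_smul _ _
    rw [h2, ← inner_smul_right, hsm, Quaternion.coeComplex_coe]
  have h3 : inn (U₀ x) y = inn x (op (ε : ℍ) • U₀ y) := by
    refine aux_full inn hinn _ _ _ _ fun q => ?_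
    refine (hU' q).trans ?_
    rw [hin, smul_smul, smul_smul, ← op_mul, ← op_mul, Quaternion.coe_commutes]
  rw [h3, hinn.smul_right, Quaternion.coe_commutes]

/-- if `T` is densely defined, closed, with polar decomposition
`T = U₀ |T|`, `N(U₀) = N(T)`, then: if `T` is self-adjoint (`T* = T`) then `U₀` is
self-adjoint, and if `T` is anti self-adjoint (`T* = -T`) then `U₀` is anti
self-adjoint. -/
theorem polar_decomposition_selfadjoint_anti
    [CompleteSpace H] (inn : H → H → ℍ) (hinn : QInner inn)
    (T Ts TsT modT : H →ₗ.[ℍᵐᵒᵖ] H) (U₀ : H →L[ℍᵐᵒᵖ] H)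
    (hdense : Dense (T.domain : Set H))
    (hclosed : IsClosed (T.graph : Set (H × H)))
    (hadj : IsAdjP inn T Ts)
    (hcomp : IsCompP Ts T TsT)
    (hmodpos : IsPosP inn modT) (hmodsq : IsCompP modT modT TsT)
    (hU : IsPartialIsomB inn U₀) (hker : kerB U₀ = pKer T)
    (hfact : EqCompB T U₀ modT) :
    (Ts = T → IsAdjB inn U₀ U₀) ∧
    (Ts = -T → IsAdjB inn U₀ (-U₀)) := by
  have hmain := aux_main inn hinn T modT U₀
  obtain ⟨hc1, hc2⟩ := hcomp
  obtain ⟨hm1, hm2⟩ := hmodsq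
  have hneg : ∀ u v : H, inn (-u) v = - inn u v := fun u v => by
    have : inn v (-u) = - inn v u := by
      have h := hinn.smul_right v u (-1)
      simpa using h
    rw [hinn.conj_symm, this, star_neg, ← hinn.conj_symm]
  constructor
  · rintro rfl
    have := hmain 1 (Or.inl rfl) hdense hclosed (fun a b => by simpa using hadj.1 a b) hadj.2
      hmodpos
      (by
        rintro ⟨a, ha⟩ ⟨b, hb⟩ (rfl : a = b)
        exact ⟨fun h => ((hm1 a).1 ((hc1 a).2 ⟨ha, h⟩)).2,
          fun h => ((hc1 a).1 ((hm1 a).2 ⟨hb, h⟩)).2⟩)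
      (by
        rintro ⟨a, ha⟩ ⟨b, hb⟩ (rfl : a = b) h h'
        have hd := (hc1 a).2 ⟨ha, h⟩
        rw [← hc2 ⟨a, hd⟩ ha h, hm2 ⟨a, hd⟩ hb h']
        simp)
      hU hker hfact
    intro x y
    simpa using this x y
  · rintro rfl
    have := hmain (-1) (Or.inr rfl) hdense hclosed
      (fun a b => by
        have := hadj.1 a b
        rw [LinearPMap.neg_apply, hneg] at this
        simpa using this) hadj.2
      hmodpos
      (by
        rintro ⟨a, ha⟩ ⟨b, hb⟩ (rfl : a = b)
        exact ⟨fun h => ((hm1 a).1 ((hc1 a).2 ⟨ha, h⟩)).2,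
          fun h => ((hc1 a).1 ((hm1 a).2 ⟨hb, h⟩)).2⟩)
      (by
        rintro ⟨a, ha⟩ ⟨b, hb⟩ (rfl : a = b) h h'
        have hd := (hc1 a).2 ⟨ha, h⟩
        have h1 := hc2 ⟨a, hd⟩ ha h
        rw [hm2 ⟨a, hd⟩ hb h', LinearPMap.neg_apply] at h1
        rw [h1]
        simp)
      hU hker hfact
    intro x y
    have h := this x y
    rw [_root_.neg_apply, hneg, h]
    simp
end
end
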